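/- Let κ > 0 and let ε ∈ (0, 1/(κ+1)). Define L_κ(x) = −Σ_{ℓ≥1} log(1 − e^{−x·⌊ℓ^κ⌋}) for x > 0. Then there exist C > 0 and N₀ such that for every integer n ≥ N₀ there is a real x > 0 satisfying L_κ'(x) + n = 0 and | p_κ(n) · √(2π·L_κ''(x)) · e^{−L_κ(x) − n·x} − 1 | ≤ C·n^{−1/(κ+1)+ε}. -/

import Mathlib

open Filter Topology Real

/-- The Piatetski-Shapiro part: `⌊ℓ^κ⌋`. -/
noncomputable def psPart (κ : ℝ) (ℓ : ℕ) : ℕ := ⌊(ℓ : ℝ) ^ κ⌋₊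

/-- `p_κ(n)`: number of partitions of `n` into parts from `(⌊ℓ^κ⌋)_{ℓ ≥ 1}`. -/
noncomputable def pk (κ : ℝ) (n : ℕ) : ℕ :=
  Nat.card {r : ℕ →₀ ℕ // (r.sum fun ℓ j => j * psPart κ (ℓ + 1)) = n}

/-- `L_κ(x) = -∑_{ℓ ≥ 1} log(1 - e^{-x⌊ℓ^κ⌋})`. -/
noncomputable def Lk (κ : ℝ) (x : ℝ) : ℝ :=
  -∑' ℓ : ℕ, Real.log (1 - Real.exp (-x * (psPart κ (ℓ + 1) : ℝ)))

/-! ### Parts outside a residue class -/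

/-- The sequence `w` is dense modulo one along arbitrarily long runs of consecutive indices: every
residue is approximated by all terms of a run. -/
def DenseRunsModOne (w : ℕ → ℝ) : Prop :=
  ∀ c : ℝ, ∀ δ > 0, ∀ H ℓ₀ : ℕ, ∃ ℓ ≥ ℓ₀, ∀ h ≤ H, ∃ k : ℤ, |w (ℓ + h) - c - k| ≤ δ

lemma exists_abs_sub_le_of_increments {v : ℕ → ℝ} {c η : ℝ} {N H : ℕ} (hη : 0 ≤ η)
    (h0 : v 0 ≤ c) (hN : c ≤ v N) (hv : ∀ i < N + H, |v (i + 1) - v i| ≤ η) :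
    ∃ i ≤ N, ∀ h ≤ H, |v (i + h) - c| ≤ (h + 1) * η := by
  classical
  have hex : ∃ i, c ≤ v i := ⟨N, hN⟩
  have hle : Nat.find hex ≤ N := Nat.find_min' hex hN
  have hspec := Nat.find_spec hex
  have hmin : ∀ j < Nat.find hex, v j < c := fun j hj => not_le.mp (Nat.find_min hex hj)
  generalize Nat.find hex = i at hle hspec hmin
  refine ⟨i, hle, fun h => ?_⟩
  induction h with
  | zero =>
    intro _
    have hη : |v i - c| ≤ η := by
      rcases i with _ | j
      · simpa [le_antisymm h0 hspec] using hη
      · have h1 := hmin j (by omega)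
        have h2 := (abs_le.mp (hv j (by omega))).2
        rw [abs_le]; constructor <;> linarith
    simpa using hη
  | succ h ih =>
    intro hh
    have h1 := ih (by omega)
    have h2 := hv (i + h) (by omega)
    have h3 : v (i + (h + 1)) - c = (v (i + h + 1) - v (i + h)) + (v (i + h) - c) := by
      rw [← add_assoc]; ring
    rw [h3]; push_cast
    refine (abs_add_le _ _).trans ?_
    linarith

lemma denseRunsModOne_of_tendsto {w : ℕ → ℝ} (hw : Tendsto w atTop atTop)
    (hd : Tendsto (fun ℓ => w (ℓ + 1) - w ℓ) atTop (𝓝 0)) : DenseRunsModOne w := by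
  intro c δ hδ H ℓ₀
  have hη : 0 < δ / (H + 1) := by positivity
  obtain ⟨ℓ₁, h₁⟩ := eventually_atTop.mp
    (hd.eventually (Metric.closedBall_mem_nhds (0 : ℝ) hη))
  set m := max ℓ₀ ℓ₁
  obtain ⟨N, hN⟩ := eventually_atTop.mp
    (hw.eventually (eventually_ge_atTop (c + ⌈w m - c⌉)))
  obtain ⟨i, -, hi⟩ := exists_abs_sub_le_of_increments (v := fun i => w (m + i))
    (c := c + ⌈w m - c⌉) (N := N) (H := H) hη.le
    (by have := Int.le_ceil (w m - c); simp only [add_zero]; linarith) (hN _ (by omega))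
    (fun i _ => by
      have := h₁ (m + i) (by have := le_max_right ℓ₀ ℓ₁; omega)
      simpa [Real.dist_eq, add_assoc] using this)
  refine ⟨m + i, by have := le_max_left ℓ₀ ℓ₁; omega, fun h hh => ⟨⌈w m - c⌉, ?_⟩⟩
  have := hi h hh
  rw [← add_assoc] at this
  have hle : ((h : ℝ) + 1) * (δ / (H + 1)) ≤ δ := by
    rw [← mul_div_assoc, div_le_iff₀ (by positivity), mul_comm]
    have : (h : ℝ) ≤ H := by exact_mod_cast hh
    gcongr
  rw [sub_sub]
  exact this.trans hle

lemma DenseRunsModOne.of_fwdDiff {w : ℕ → ℝ} (hw : DenseRunsModOne (fwdDiff 1 w)) :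
    DenseRunsModOne w := by
  intro c δ hδ H ℓ₀
  set ε : ℝ := δ / (H + 1)
  have hε : 0 < ε := by positivity
  obtain ⟨N, hN⟩ := exists_nat_gt (2 / ε)
  obtain ⟨ℓ, hℓ, hk⟩ := hw (3 * ε / 4) (ε / 4) (by positivity) (N + H) ℓ₀
  choose! k hk using hk
  set v : ℕ → ℝ := fun i => w (ℓ + i) - ((∑ j ∈ Finset.range i, k j : ℤ) : ℝ) with hvdef
  have hinc : ∀ i ≤ N + H, ε / 2 ≤ v (i + 1) - v i ∧ v (i + 1) - v i ≤ ε := by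
    intro i hi
    have h1 := abs_le.mp (hk i hi)
    have h2 : v (i + 1) - v i = fwdDiff 1 w (ℓ + i) - k i := by
      simp only [hvdef, fwdDiff, Finset.sum_range_succ, Int.cast_add, add_assoc]; ring
    rw [h2]; constructor <;> linarith [h1.1, h1.2]
  have hgrow : ∀ i ≤ N, v 0 + i * (ε / 2) ≤ v i := by
    intro i
    induction i with
    | zero => simp
    | succ i ih =>
      intro hi
      have h1 := ih (by omega)
      have h2 := (hinc i (by omega)).1
      push_cast; linarith
  have hNε : 1 ≤ N * (ε / 2) := by
    rw [div_lt_iff₀ hε] at hN; linarith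
  have hceil := Int.ceil_lt_add_one (v 0 - c)
  obtain ⟨i, -, hi⟩ := exists_abs_sub_le_of_increments (v := v)
    (c := c + ⌈v 0 - c⌉) (N := N) (H := H) hε.le
    (by have := Int.le_ceil (v 0 - c); linarith) (by linarith [hgrow N le_rfl])
    (fun i hi => by
      have := hinc i hi.le
      rw [abs_le]; constructor <;> linarith)
  refine ⟨ℓ + i, by omega, fun h hh =>
    ⟨⌈v 0 - c⌉ + ∑ j ∈ Finset.range (i + h), k j, ?_⟩⟩
  have hle : ((h : ℝ) + 1) * ε ≤ δ := by
    rw [← mul_div_assoc, div_le_iff₀ (by positivity), mul_comm]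
    have : (h : ℝ) ≤ H := by exact_mod_cast hh
    gcongr
  refine le_trans (le_of_eq ?_) ((hi h hh).trans hle)
  simp only [hvdef, add_assoc, Int.cast_add]
  congr 1; ring

lemma DenseRunsModOne.of_fwdDiff_iterate {w : ℕ → ℝ} {d : ℕ}
    (hw : DenseRunsModOne ((fwdDiff 1)^[d] w)) : DenseRunsModOne w := by
  induction d with
  | zero => simpa using hw
  | succ d ih =>
    rw [Function.iterate_succ_apply'] at hw
    exact ih hw.of_fwdDiff

lemma hasDerivAt_fwdDiff_iterate {f f' : ℝ → ℝ} (hf : ∀ x > 0, HasDerivAt f (f' x) x) (j : ℕ) :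
    ∀ x > 0, HasDerivAt ((fwdDiff 1)^[j] f) ((fwdDiff 1)^[j] f' x) x := by
  induction j with
  | zero => simpa using hf
  | succ j ih =>
    intro x hx
    rw [Function.iterate_succ_apply', Function.iterate_succ_apply']
    exact ((ih (x + 1) (by linarith)).comp_add_const x 1).sub (ih x hx)

lemma exists_fwdDiff_iterate_rpow_eq (j : ℕ) : ∀ (A κ : ℝ), ∀ x > 0, ∃ ξ ≥ x,
    (fwdDiff 1)^[j] (fun y : ℝ => A * y ^ κ) x =
      A * (∏ i ∈ Finset.range j, (κ - i)) * ξ ^ (κ - j) := by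
  induction j with
  | zero => intro A κ x _; exact ⟨x, le_rfl, by simp⟩
  | succ j ih =>
    intro A κ x hx
    have hder := hasDerivAt_fwdDiff_iterate (f := fun y : ℝ => A * y ^ κ)
      (f' := fun y => A * κ * y ^ (κ - 1)) (fun y hy => by
        simpa [mul_assoc] using (hasDerivAt_rpow_const (p := κ) (Or.inl hy.ne')).const_mul A) j
    obtain ⟨ξ, hξ, h⟩ := exists_hasDerivAt_eq_slope _ _ (lt_add_one x)
      (fun y hy => (hder y (hx.trans_le hy.1)).continuousAt.continuousWithinAt)
      (fun y hy => hder y (hx.trans hy.1))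
    obtain ⟨ξ', hξ', h'⟩ := ih (A * κ) (κ - 1) ξ (hx.trans hξ.1)
    refine ⟨ξ', hξ.1.le.trans hξ', ?_⟩
    rw [Function.iterate_succ_apply', fwdDiff]
    have h2 : ∏ i ∈ Finset.range (j + 1), (κ - i) = κ * ∏ i ∈ Finset.range j, (κ - 1 - i) := by
      rw [Finset.prod_range_succ', mul_comm]
      simp only [Nat.cast_zero, sub_zero, Nat.cast_add, Nat.cast_one]
      congr 1
      exact Finset.prod_congr rfl fun i _ => by ring
    have h3 : κ - 1 - (j : ℝ) = κ - ((j + 1 : ℕ) : ℝ) := by push_cast; ring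
    rw [h', add_sub_cancel_left, div_one, h3] at h
    rw [← h, h2]; ring

lemma fwdDiff_iterate_natCast (f : ℝ → ℝ) (j : ℕ) (x : ℝ) (ℓ : ℕ) :
    (fwdDiff 1)^[j] (fun m : ℕ => f (m + x)) ℓ = (fwdDiff 1)^[j] f (ℓ + x) := by
  induction j generalizing ℓ with
  | zero => simp
  | succ j ih =>
    rw [Function.iterate_succ_apply', Function.iterate_succ_apply', fwdDiff, fwdDiff, ih, ih]
    rw [Nat.cast_succ, add_right_comm]

lemma denseRunsModOne_rpow {A κ : ℝ} (hA : 0 < A) (hκ : 0 < κ) (hint : (⌊κ⌋₊ : ℝ) ≠ κ) :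
    DenseRunsModOne fun ℓ : ℕ => A * ((ℓ : ℝ) + 1) ^ κ := by
  set d := ⌊κ⌋₊
  have hd : (d : ℝ) < κ := lt_of_le_of_ne (Nat.floor_le hκ.le) hint
  have hd' : κ < d + 1 := Nat.lt_floor_add_one κ
  have hP : 0 < ∏ i ∈ Finset.range d, (κ - i) := by
    refine Finset.prod_pos fun i hi => ?_
    have : (i : ℝ) < d := by exact_mod_cast Finset.mem_range.mp hi
    linarith
  have hcast : Tendsto (fun ℓ : ℕ => (ℓ : ℝ) + 1) atTop atTop :=
    tendsto_natCast_atTop_atTop.atTop_add tendsto_const_nhds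
  have hiter : ∀ j ℓ : ℕ, (fwdDiff 1)^[j] (fun ℓ : ℕ => A * ((ℓ : ℝ) + 1) ^ κ) ℓ =
      (fwdDiff 1)^[j] (fun y : ℝ => A * y ^ κ) (ℓ + 1) :=
    fun j ℓ => fwdDiff_iterate_natCast (fun y : ℝ => A * y ^ κ) j 1 ℓ
  refine DenseRunsModOne.of_fwdDiff_iterate (d := d) (denseRunsModOne_of_tendsto ?_ ?_)
  · refine tendsto_atTop_mono (f := fun ℓ : ℕ =>
      A * (∏ i ∈ Finset.range d, (κ - i)) * ((ℓ : ℝ) + 1) ^ (κ - d)) (fun ℓ => ?_) ?_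
    · obtain ⟨ξ, hξ, h⟩ := exists_fwdDiff_iterate_rpow_eq d A κ (ℓ + 1) (by positivity)
      rw [hiter, h]
      have : ((ℓ : ℝ) + 1) ^ (κ - d) ≤ ξ ^ (κ - d) :=
        rpow_le_rpow (by positivity) hξ (by linarith)
      gcongr
    · exact ((tendsto_rpow_atTop (by linarith)).comp hcast).const_mul_atTop (by positivity)
  · set B := ∏ i ∈ Finset.range (d + 1), (κ - i)
    refine squeeze_zero_norm (a := fun ℓ : ℕ =>
      |A * B| * ((ℓ : ℝ) + 1) ^ (-((d : ℝ) + 1 - κ))) (fun ℓ => ?_) ?_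
    · obtain ⟨ξ, hξ, h⟩ := exists_fwdDiff_iterate_rpow_eq (d + 1) A κ (ℓ + 1) (by positivity)
      have hdef : (fwdDiff 1)^[d] (fun ℓ : ℕ => A * ((ℓ : ℝ) + 1) ^ κ) (ℓ + 1) -
          (fwdDiff 1)^[d] (fun ℓ : ℕ => A * ((ℓ : ℝ) + 1) ^ κ) ℓ =
          (fwdDiff 1)^[d + 1] (fun ℓ : ℕ => A * ((ℓ : ℝ) + 1) ^ κ) ℓ := by
        rw [Function.iterate_succ_apply', fwdDiff]
      have hξ0 : 0 < ξ := lt_of_lt_of_le (by positivity) hξ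
      rw [hdef, hiter, h, norm_mul, Real.norm_eq_abs, Real.norm_eq_abs,
        abs_of_pos (rpow_pos_of_pos hξ0 _)]
      refine mul_le_mul_of_nonneg_left ?_ (abs_nonneg _)
      have he : κ - ((d + 1 : ℕ) : ℝ) = -((d : ℝ) + 1 - κ) := by push_cast; ring
      rw [he]
      exact rpow_le_rpow_of_nonpos (by positivity) hξ (by linarith)
    · have := ((tendsto_rpow_neg_atTop (y := (d : ℝ) + 1 - κ) (by linarith)).comp
        hcast).const_mul |A * B|
      simpa using this

lemma exists_not_dvd_psPart {κ : ℝ} (hκ : 0 < κ) {q : ℕ} (hq : 2 ≤ q) (ℓ₀ : ℕ) :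
    ∃ ℓ ≥ ℓ₀, ¬ q ∣ psPart κ (ℓ + 1) := by
  by_cases hint : (⌊κ⌋₊ : ℝ) = κ
  · refine ⟨q * ℓ₀, Nat.le_mul_of_pos_left _ (by omega), fun hdvd => ?_⟩
    have h1 : psPart κ (q * ℓ₀ + 1) = (q * ℓ₀ + 1) ^ ⌊κ⌋₊ := by
      rw [psPart, ← hint, rpow_natCast, Nat.floor_natCast]
      exact_mod_cast Nat.floor_natCast (R := ℝ) ((q * ℓ₀ + 1) ^ ⌊κ⌋₊)
    have hcop : Nat.Coprime q ((q * ℓ₀ + 1) ^ ⌊κ⌋₊) := by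
      refine Nat.Coprime.pow_right _ ?_
      simp
    rw [h1] at hdvd
    have := Nat.Coprime.eq_one_of_dvd hcop hdvd
    omega
  · have hq0 : (0 : ℝ) < q := by positivity
    obtain ⟨ℓ, hℓ, h⟩ := denseRunsModOne_rpow (A := 1 / q) (by positivity) hκ hint
      (3 / 4) (1 / 8) (by norm_num) 0 ℓ₀
    refine ⟨ℓ, hℓ, ?_⟩
    rintro ⟨m, hm⟩
    obtain ⟨k, hk⟩ := h 0 le_rfl
    have h0 : (0 : ℝ) ≤ ((ℓ + 1 : ℕ) : ℝ) ^ κ := by positivity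
    have hle := Nat.floor_le h0
    have hlt := Nat.lt_floor_add_one (((ℓ + 1 : ℕ) : ℝ) ^ κ)
    rw [psPart] at hm
    rw [hm] at hle hlt
    push_cast at hle hlt
    simp only [add_zero] at hk
    generalize ((ℓ : ℝ) + 1) ^ κ = y at hle hlt hk
    have h2q : (2 : ℝ) ≤ q := by exact_mod_cast hq
    have h1 : (m : ℝ) ≤ 1 / q * y := by
      rw [one_div, inv_mul_eq_div, le_div_iff₀ hq0]; linarith
    have h2 : 1 / q * y < m + 1 / 2 := by
      rw [one_div, inv_mul_eq_div, div_lt_iff₀ hq0]; nlinarith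
    have h3 := abs_le.mp hk
    have h4 : ((m - k : ℤ) : ℝ) < 1 := by push_cast; linarith [h3.1, h3.2]
    have h5 : (0 : ℝ) < ((m - k : ℤ) : ℝ) := by push_cast; linarith [h3.1, h3.2]
    have h4' : (m - k : ℤ) < 1 := by exact_mod_cast h4
    have h5' : 0 < (m - k : ℤ) := by exact_mod_cast h5
    omega

/-! ### Sums over sequences of polynomial growth -/

/-- The sequence `a` of positive integers grows like `(ℓ + 1)^κ`. -/
structure HasPowerGrowth (κ : ℝ) (a : ℕ → ℕ) : Prop where
  one_le : ∀ ℓ, 1 ≤ a ℓ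
  rpow_le : ∀ ℓ : ℕ, ((ℓ : ℝ) + 1) ^ κ ≤ 2 * a ℓ
  le_rpow : ∀ ℓ : ℕ, (a ℓ : ℝ) ≤ ((ℓ : ℝ) + 1) ^ κ

lemma hasPowerGrowth_psPart {κ : ℝ} (hκ : 0 < κ) :
    HasPowerGrowth κ fun ℓ => psPart κ (ℓ + 1) := by
  have h1 : ∀ ℓ : ℕ, 1 ≤ psPart κ (ℓ + 1) := fun ℓ => by
    rw [psPart, Nat.one_le_floor_iff]
    exact one_le_rpow (by push_cast; linarith [ℓ.cast_nonneg (α := ℝ)]) hκ.le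
  refine ⟨h1, fun ℓ => ?_, fun ℓ => ?_⟩
  · have := Nat.lt_floor_add_one (((ℓ + 1 : ℕ) : ℝ) ^ κ)
    have h2 : (1 : ℝ) ≤ psPart κ (ℓ + 1) := by exact_mod_cast h1 ℓ
    rw [psPart] at h2 ⊢
    push_cast at this h2 ⊢
    linarith
  · have := Nat.floor_le (a := ((ℓ + 1 : ℕ) : ℝ) ^ κ) (by positivity)
    rw [psPart]
    push_cast at this ⊢
    exact this

lemma HasPowerGrowth.cast_pos {κ : ℝ} {a : ℕ → ℕ} (ha : HasPowerGrowth κ a) (ℓ : ℕ) :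
    (0 : ℝ) < a ℓ := by exact_mod_cast ha.one_le ℓ

/-- The Bose factor `1 / (e^u - 1)`. -/
noncomputable def bose (u : ℝ) : ℝ := 1 / (Real.exp u - 1)

lemma bose_pos {u : ℝ} (hu : 0 < u) : 0 < bose u :=
  one_div_pos.mpr (sub_pos.mpr (Real.one_lt_exp_iff.mpr hu))

lemma bose_anti {u v : ℝ} (hu : 0 < u) (h : u ≤ v) : bose v ≤ bose u := by
  have := Real.one_lt_exp_iff.mpr hu
  exact one_div_le_one_div_of_le (by linarith) (by linarith [Real.exp_le_exp.mpr h])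

lemma bose_eq_exp_neg_div {u : ℝ} (hu : 0 < u) :
    bose u = Real.exp (-u) / (1 - Real.exp (-u)) := by
  have h1 := Real.one_lt_exp_iff.mpr hu
  rw [bose, Real.exp_neg]
  have : Real.exp u - 1 ≠ 0 := by linarith
  have : 1 - (Real.exp u)⁻¹ ≠ 0 := by
    have := inv_lt_one_of_one_lt₀ h1
    linarith
  field_simp

lemma mul_bose_le_exp {u : ℝ} (hu : 0 < u) : u * bose u ≤ Real.exp (-(u / 2)) := by
  have h1 := Real.one_lt_exp_iff.mpr hu
  have h2 := Real.self_le_sinh_iff.mpr (half_pos hu).le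
  rw [Real.sinh_eq] at h2
  rw [bose, mul_one_div, div_le_iff₀ (by linarith)]
  have h3 : Real.exp (-(u / 2)) * (Real.exp u - 1) = Real.exp (u / 2) - Real.exp (-(u / 2)) := by
    rw [mul_sub, ← Real.exp_add, mul_one]; congr 2; ring
  rw [h3]; linarith

lemma pow_mul_bose_pow_le {i j : ℕ} (hi : 1 ≤ i) (hij : i ≤ j) (hj : j ≤ 4) {u : ℝ} (hu : 0 < u) :
    u ^ j * bose u ^ i ≤ 6144 * Real.exp (-(u / 4)) := by
  obtain ⟨m, rfl⟩ := Nat.exists_eq_add_of_le hij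
  have hb := bose_pos hu
  have h1 : (u * bose u) ^ i ≤ Real.exp (-(u / 2)) := by
    have h0 := mul_bose_le_exp hu
    have hle : u * bose u ≤ 1 := h0.trans (Real.exp_le_one_iff.mpr (by linarith))
    exact (pow_le_of_le_one (by positivity) hle (by omega)).trans h0
  have h2 : u ^ m ≤ 6144 * Real.exp (u / 4) := by
    have h := Real.pow_div_factorial_le_exp (u / 4) (by positivity) m
    rw [div_pow, div_div, div_le_iff₀ (by positivity)] at h
    refine h.trans ?_
    rw [mul_comm]
    gcongr
    have hm : m ≤ 3 := by omega
    interval_cases m <;> norm_num [Nat.factorial]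
  calc u ^ (i + m) * bose u ^ i = u ^ m * (u * bose u) ^ i := by rw [mul_pow, pow_add]; ring
    _ ≤ (6144 * Real.exp (u / 4)) * Real.exp (-(u / 2)) := by gcongr
    _ = 6144 * Real.exp (-(u / 4)) := by
      rw [mul_assoc, ← Real.exp_add]; congr 2; ring

lemma HasPowerGrowth.exists_sum_exp_le {κ : ℝ} {a : ℕ → ℕ} (ha : HasPowerGrowth κ a)
    (hκ : 0 < κ) : ∃ C > 0, ∀ x > 0, ∀ N,
      ∑ ℓ ∈ Finset.range N, Real.exp (-(x * a ℓ / 4)) ≤ C * x ^ (-κ⁻¹) := by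
  have hΓ : 0 < Real.Gamma (1 / κ + 1) := Real.Gamma_pos_of_pos (by positivity)
  refine ⟨(1 / 8) ^ (-κ⁻¹) * Real.Gamma (1 / κ + 1), by positivity, fun x hx N => ?_⟩
  have hint := integral_exp_neg_mul_rpow hκ (b := x / 8) (by positivity)
  have hpos : 0 < ∫ t in Set.Ioi (0 : ℝ), Real.exp (-(x / 8) * t ^ κ) := by
    rw [hint]; positivity
  have hintegrable : MeasureTheory.IntegrableOn (fun t : ℝ => Real.exp (-(x / 8) * t ^ κ))
      (Set.Ioi 0) := by
    by_contra h
    exact hpos.ne' (MeasureTheory.integral_undef h)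
  have hanti : AntitoneOn (fun t : ℝ => Real.exp (-(x / 8) * t ^ κ)) (Set.Icc 0 (0 + (N : ℝ))) := by
    intro s hs t _ hst
    have := rpow_le_rpow hs.1 hst hκ.le
    apply Real.exp_le_exp.mpr
    rw [neg_mul, neg_mul, neg_le_neg_iff]
    gcongr
  calc ∑ ℓ ∈ Finset.range N, Real.exp (-(x * a ℓ / 4))
      ≤ ∑ ℓ ∈ Finset.range N, Real.exp (-(x / 8) * (0 + ((ℓ + 1 : ℕ) : ℝ)) ^ κ) := by
        refine Finset.sum_le_sum fun ℓ _ => Real.exp_le_exp.mpr ?_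
        have := mul_le_mul_of_nonneg_left (ha.rpow_le ℓ) hx.le
        rw [zero_add, Nat.cast_succ]
        linarith
    _ ≤ ∫ t in (0 : ℝ)..0 + N, Real.exp (-(x / 8) * t ^ κ) := hanti.sum_le_integral
    _ ≤ ∫ t in Set.Ioi (0 : ℝ), Real.exp (-(x / 8) * t ^ κ) := by
        rw [intervalIntegral.integral_of_le (by positivity)]
        exact MeasureTheory.setIntegral_mono_set hintegrable
          (Eventually.of_forall fun t => (Real.exp_pos _).le)
          (Set.Ioc_subset_Ioi_self).eventuallyLE
    _ = (1 / 8) ^ (-κ⁻¹) * Real.Gamma (1 / κ + 1) * x ^ (-κ⁻¹) := by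
        rw [hint, neg_div, one_div κ, div_eq_mul_one_div x 8,
          mul_rpow hx.le (by norm_num)]
        ring

lemma HasPowerGrowth.exists_tsum_pow_mul_bose_pow_le {κ : ℝ} {a : ℕ → ℕ}
    (ha : HasPowerGrowth κ a) (hκ : 0 < κ) : ∃ C > 0, ∀ x > 0, ∀ i j : ℕ, 1 ≤ i → i ≤ j → j ≤ 4 →
      Summable (fun ℓ => (a ℓ : ℝ) ^ j * bose (x * a ℓ) ^ i) ∧
      ∑' ℓ, (a ℓ : ℝ) ^ j * bose (x * a ℓ) ^ i ≤ C * x ^ (-κ⁻¹ - j) := by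
  obtain ⟨C, hC, h⟩ := ha.exists_sum_exp_le hκ
  refine ⟨6144 * C, by positivity, fun x hx i j hi hij hj => ?_⟩
  have hnonneg : ∀ ℓ, 0 ≤ (a ℓ : ℝ) ^ j * bose (x * a ℓ) ^ i := fun ℓ =>
    mul_nonneg (by positivity) (pow_nonneg (bose_pos (mul_pos hx (ha.cast_pos ℓ))).le _)
  have hsum : ∀ N, ∑ ℓ ∈ Finset.range N, (a ℓ : ℝ) ^ j * bose (x * a ℓ) ^ i ≤
      6144 * C * x ^ (-κ⁻¹ - j) := fun N => by
    have hx' : x ^ (-κ⁻¹ - j) = x ^ (-κ⁻¹) / x ^ j := by rw [rpow_sub hx, rpow_natCast]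
    rw [hx', ← mul_div_assoc, le_div_iff₀ (by positivity), Finset.sum_mul]
    calc ∑ ℓ ∈ Finset.range N, (a ℓ : ℝ) ^ j * bose (x * a ℓ) ^ i * x ^ j
        ≤ ∑ ℓ ∈ Finset.range N, 6144 * Real.exp (-(x * a ℓ / 4)) := by
          refine Finset.sum_le_sum fun ℓ _ => ?_
          refine le_trans (le_of_eq ?_)
            (pow_mul_bose_pow_le hi hij hj (mul_pos hx (ha.cast_pos ℓ)))
          rw [mul_pow]; ring
      _ ≤ 6144 * C * x ^ (-κ⁻¹) := by
          rw [← Finset.mul_sum, mul_assoc]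
          exact mul_le_mul_of_nonneg_left (h x hx N) (by norm_num)
  exact ⟨summable_of_sum_range_le hnonneg hsum, Real.tsum_le_of_sum_range_le hnonneg hsum⟩

lemma HasPowerGrowth.summable_pow_mul_bose_pow {κ : ℝ} {a : ℕ → ℕ}
    (ha : HasPowerGrowth κ a) (hκ : 0 < κ) {x : ℝ} (hx : 0 < x) {i j : ℕ} (hi : 1 ≤ i)
    (hij : i ≤ j) (hj : j ≤ 4) :
    Summable fun ℓ => (a ℓ : ℝ) ^ j * bose (x * a ℓ) ^ i := by
  obtain ⟨C, -, h⟩ := ha.exists_tsum_pow_mul_bose_pow_le hκ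
  exact (h x hx i j hi hij hj).1

/-- The expected value of the weight of a random partition with parts in `a`. -/
noncomputable def boseMean (a : ℕ → ℕ) (x : ℝ) : ℝ := ∑' ℓ, (a ℓ : ℝ) * bose (x * a ℓ)

/-- The variance of the weight of a random partition with parts in `a`. -/
noncomputable def boseVar (a : ℕ → ℕ) (x : ℝ) : ℝ :=
  ∑' ℓ, (a ℓ : ℝ) ^ 2 * (bose (x * a ℓ) + bose (x * a ℓ) ^ 2)

lemma HasPowerGrowth.summable_boseMean {κ : ℝ} {a : ℕ → ℕ}
    (ha : HasPowerGrowth κ a) (hκ : 0 < κ) {x : ℝ} (hx : 0 < x) :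
    Summable fun ℓ => (a ℓ : ℝ) * bose (x * a ℓ) := by
  simpa using ha.summable_pow_mul_bose_pow hκ hx (i := 1) (j := 1) le_rfl le_rfl (by norm_num)

lemma HasPowerGrowth.summable_boseVar {κ : ℝ} {a : ℕ → ℕ}
    (ha : HasPowerGrowth κ a) (hκ : 0 < κ) {x : ℝ} (hx : 0 < x) :
    Summable fun ℓ => (a ℓ : ℝ) ^ 2 * (bose (x * a ℓ) + bose (x * a ℓ) ^ 2) := by
  have h1 := ha.summable_pow_mul_bose_pow hκ hx (i := 1) (j := 2) le_rfl (by norm_num) (by norm_num)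
  have h2 := ha.summable_pow_mul_bose_pow hκ hx (i := 2) (j := 2) (by norm_num) le_rfl (by norm_num)
  simpa [mul_add] using h1.add h2

lemma HasPowerGrowth.exists_boseMean_le {κ : ℝ} {a : ℕ → ℕ}
    (ha : HasPowerGrowth κ a) (hκ : 0 < κ) :
    ∃ C > 0, ∀ x > 0, boseMean a x ≤ C * x ^ (-κ⁻¹ - 1) := by
  obtain ⟨C, hC, h⟩ := ha.exists_tsum_pow_mul_bose_pow_le hκ
  refine ⟨C, hC, fun x hx => ?_⟩
  simpa [boseMean] using (h x hx 1 1 le_rfl le_rfl (by norm_num)).2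

lemma half_le_floor {y : ℝ} (hy : 1 ≤ y) : y / 2 ≤ ⌊y⌋₊ := by
  have h1 := Nat.lt_floor_add_one y
  have h2 : (1 : ℝ) ≤ ⌊y⌋₊ := by exact_mod_cast (Nat.one_le_floor_iff y).mpr hy
  linarith

lemma HasPowerGrowth.mul_le_one {κ : ℝ} {a : ℕ → ℕ} (ha : HasPowerGrowth κ a)
    (hκ : 0 < κ) {x : ℝ} (hx : 0 < x) {ℓ : ℕ} (hℓ : ℓ ∈ Finset.range ⌊x ^ (-κ⁻¹)⌋₊) :
    x * a ℓ ≤ 1 := by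
  have h1 : ((ℓ : ℝ) + 1) ≤ x ^ (-κ⁻¹) := by
    refine le_trans ?_ (Nat.floor_le (by positivity))
    exact_mod_cast Finset.mem_range.mp hℓ
  have h2 := rpow_le_rpow (by positivity) h1 hκ.le
  rw [← rpow_mul hx.le, neg_mul, inv_mul_cancel₀ hκ.ne', rpow_neg_one] at h2
  calc x * a ℓ ≤ x * x⁻¹ := by gcongr; exact (ha.le_rpow ℓ).trans h2
    _ = 1 := mul_inv_cancel₀ hx.ne'

lemma HasPowerGrowth.le_boseVar {κ : ℝ} {a : ℕ → ℕ} (ha : HasPowerGrowth κ a)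
    (hκ : 0 < κ) {x : ℝ} (hx : 0 < x) (hx1 : x ≤ 1) :
    1 / 8 * x ^ (-κ⁻¹ - 2) ≤ boseVar a x := by
  have hpos : ∀ ℓ, 0 ≤ (a ℓ : ℝ) ^ 2 * (bose (x * a ℓ) + bose (x * a ℓ) ^ 2) := fun ℓ => by
    have := bose_pos (mul_pos hx (ha.cast_pos ℓ))
    positivity
  have hterm : ∀ ℓ ∈ Finset.range ⌊x ^ (-κ⁻¹)⌋₊,
      1 / (4 * x ^ 2) ≤ (a ℓ : ℝ) ^ 2 * (bose (x * a ℓ) + bose (x * a ℓ) ^ 2) := by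
    intro ℓ hℓ
    have h1 := ha.mul_le_one hκ hx hℓ
    have ha0 := ha.cast_pos ℓ
    have hu : 0 < x * a ℓ := mul_pos hx ha0
    have hb := bose_pos hu
    have h2 : 1 / 2 ≤ (x * a ℓ) * bose (x * a ℓ) := by
      generalize x * (a ℓ : ℝ) = u at *
      have h3 := Real.one_lt_exp_iff.mpr hu
      have h4 := Real.abs_exp_sub_one_le (x := u) (by rw [abs_of_pos hu]; exact h1)
      rw [abs_of_pos (by linarith), abs_of_pos hu] at h4
      rw [bose, mul_one_div, div_le_div_iff₀ (by norm_num) (by linarith)]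
      linarith
    rw [div_le_iff₀ (by positivity)]
    have h5 : (1 / 2) ^ 2 ≤ ((x * a ℓ) * bose (x * a ℓ)) ^ 2 := by gcongr
    have h6 : 0 ≤ (a ℓ : ℝ) ^ 2 * bose (x * a ℓ) * (4 * x ^ 2) := by positivity
    nlinarith
  calc 1 / 8 * x ^ (-κ⁻¹ - 2) = x ^ (-κ⁻¹) / 2 * (1 / (4 * x ^ 2)) := by
        rw [rpow_sub hx, rpow_two]; field_simp; norm_num
    _ ≤ ⌊x ^ (-κ⁻¹)⌋₊ * (1 / (4 * x ^ 2)) := by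
        gcongr
        exact half_le_floor (one_le_rpow_of_pos_of_le_one_of_nonpos hx hx1
          (by have := inv_pos.mpr hκ; linarith))
    _ ≤ ∑ ℓ ∈ Finset.range ⌊x ^ (-κ⁻¹)⌋₊,
          (a ℓ : ℝ) ^ 2 * (bose (x * a ℓ) + bose (x * a ℓ) ^ 2) := by
        rw [← nsmul_eq_mul]
        simpa using Finset.card_nsmul_le_sum _ _ _ hterm
    _ ≤ boseVar a x := (ha.summable_boseVar hκ hx).sum_le_tsum _ fun ℓ _ => hpos ℓ

lemma hasDerivAt_bose {u : ℝ} (hu : 0 < u) : HasDerivAt bose (-(bose u + bose u ^ 2)) u := by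
  have h1 := Real.one_lt_exp_iff.mpr hu
  have hne : Real.exp u - 1 ≠ 0 := by linarith
  have := ((Real.hasDerivAt_exp u).sub_const 1).fun_inv hne
  have h2 : bose = fun y => (Real.exp y - 1)⁻¹ := by funext y; rw [bose, one_div]
  rw [h2]
  refine this.congr_deriv ?_
  field_simp
  ring

lemma hasDerivAt_log_one_sub_exp {u : ℝ} (hu : 0 < u) :
    HasDerivAt (fun y => Real.log (1 - Real.exp (-y))) (bose u) u := by
  have h1 : Real.exp (-u) < 1 := Real.exp_lt_one_iff.mpr (by linarith)
  have := (((Real.hasDerivAt_exp (-u)).comp u (hasDerivAt_neg u)).const_sub 1).log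
    (by simp only [Function.comp]; linarith)
  rw [bose_eq_exp_neg_div hu]
  refine this.congr_deriv ?_
  simp [Function.comp]

lemma abs_log_one_sub_exp_le {u : ℝ} (hu : 0 < u) :
    |Real.log (1 - Real.exp (-u))| ≤ bose u := by
  have h1 : Real.exp (-u) < 1 := Real.exp_lt_one_iff.mpr (by linarith)
  have h0 : 0 < 1 - Real.exp (-u) := by linarith
  have h2 := Real.one_sub_inv_le_log_of_pos h0
  have h3 := Real.log_nonpos h0.le (by linarith [Real.exp_pos (-u)])
  rw [abs_of_nonpos h3, bose_eq_exp_neg_div hu]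
  have h4 : Real.exp (-u) / (1 - Real.exp (-u)) = (1 - Real.exp (-u))⁻¹ - 1 := by
    field_simp; ring
  rw [h4]; linarith

lemma HasPowerGrowth.summable_bose {κ : ℝ} {a : ℕ → ℕ} (ha : HasPowerGrowth κ a)
    (hκ : 0 < κ) {x : ℝ} (hx : 0 < x) : Summable fun ℓ => bose (x * a ℓ) := by
  refine Summable.of_nonneg_of_le (fun ℓ => (bose_pos (mul_pos hx (ha.cast_pos ℓ))).le)
    (fun ℓ => ?_) (ha.summable_boseMean hκ hx)
  exact le_mul_of_one_le_left (bose_pos (mul_pos hx (ha.cast_pos ℓ))).le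
    (by exact_mod_cast ha.one_le ℓ)

lemma HasPowerGrowth.hasDerivAt_neg_tsum_log {κ : ℝ} {a : ℕ → ℕ} (ha : HasPowerGrowth κ a)
    (hκ : 0 < κ) {x : ℝ} (hx : 0 < x) :
    HasDerivAt (fun y => -∑' ℓ, Real.log (1 - Real.exp (-y * (a ℓ : ℝ)))) (-boseMean a x) x := by
  have hx2 : 0 < x / 2 := by positivity
  have hmem : x ∈ Set.Ioi (x / 2) := by simp only [Set.mem_Ioi]; linarith
  refine (hasDerivAt_tsum_of_isPreconnected (ha.summable_boseMean hκ hx2) isOpen_Ioi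
    isPreconnected_Ioi (g := fun ℓ y => Real.log (1 - Real.exp (-y * (a ℓ : ℝ))))
    (g' := fun ℓ y => (a ℓ : ℝ) * bose (y * a ℓ)) (fun ℓ y hy => ?_) (fun ℓ y hy => ?_)
    hmem ?_ hmem).neg
  · have hy0 : 0 < y * a ℓ := mul_pos (hx2.trans hy) (ha.cast_pos ℓ)
    have := (hasDerivAt_log_one_sub_exp hy0).comp y ((hasDerivAt_id y).mul_const (a ℓ : ℝ))
    simpa [Function.comp_def, mul_comm] using this
  · have hy0 : 0 < y * a ℓ := mul_pos (hx2.trans hy) (ha.cast_pos ℓ)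
    rw [Real.norm_eq_abs, abs_of_pos (mul_pos (ha.cast_pos ℓ) (bose_pos hy0))]
    refine mul_le_mul_of_nonneg_left (bose_anti (mul_pos hx2 (ha.cast_pos ℓ)) ?_)
      (ha.cast_pos ℓ).le
    exact mul_le_mul_of_nonneg_right (le_of_lt hy) (ha.cast_pos ℓ).le
  · refine Summable.of_norm_bounded (ha.summable_bose hκ hx) fun ℓ => ?_
    rw [neg_mul]
    exact abs_log_one_sub_exp_le (mul_pos hx (ha.cast_pos ℓ))

lemma HasPowerGrowth.hasDerivAt_boseMean {κ : ℝ} {a : ℕ → ℕ} (ha : HasPowerGrowth κ a)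
    (hκ : 0 < κ) {x : ℝ} (hx : 0 < x) : HasDerivAt (boseMean a) (-boseVar a x) x := by
  have hx2 : 0 < x / 2 := by positivity
  have hmem : x ∈ Set.Ioi (x / 2) := by simp only [Set.mem_Ioi]; linarith
  have h := hasDerivAt_tsum_of_isPreconnected (ha.summable_boseVar hκ hx2) isOpen_Ioi
    isPreconnected_Ioi (g := fun ℓ y => (a ℓ : ℝ) * bose (y * a ℓ))
    (g' := fun ℓ y => -((a ℓ : ℝ) ^ 2 * (bose (y * a ℓ) + bose (y * a ℓ) ^ 2)))
    (fun ℓ y hy => ?_) (fun ℓ y hy => ?_) hmem (ha.summable_boseMean hκ hx) hmem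
  · rw [tsum_neg] at h
    exact h
  · have hy0 : 0 < y * a ℓ := mul_pos (hx2.trans hy) (ha.cast_pos ℓ)
    have := ((hasDerivAt_bose hy0).comp y ((hasDerivAt_id y).mul_const (a ℓ : ℝ))).const_mul
      (a ℓ : ℝ)
    refine this.congr_deriv ?_
    ring
  · have hy0 : 0 < y * a ℓ := mul_pos (hx2.trans hy) (ha.cast_pos ℓ)
    have hb := bose_pos hy0
    rw [norm_neg, Real.norm_eq_abs, abs_of_nonneg (by positivity)]
    have h1 : bose (y * a ℓ) ≤ bose (x / 2 * a ℓ) :=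
      bose_anti (mul_pos hx2 (ha.cast_pos ℓ))
        (mul_le_mul_of_nonneg_right (le_of_lt hy) (ha.cast_pos ℓ).le)
    gcongr

/-! ### Counting representations by contour integration -/

/-- Representations of `n` as a weighted sum of the first `M` parts. -/
def partReps (a : ℕ → ℕ) (M n : ℕ) : Set (ℕ →₀ ℕ) :=
  {r | r.support ⊆ Finset.range M ∧ (r.sum fun ℓ j => j * a ℓ) = n}

lemma finite_partReps {a : ℕ → ℕ} (ha : ∀ ℓ, 1 ≤ a ℓ) (M n : ℕ) : (partReps a M n).Finite := by
  refine ((Finset.range M).finsupp fun _ => Finset.range (n + 1)).finite_toSet.subset ?_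
  rintro r ⟨hr, hn⟩
  rw [Finset.mem_coe, Finset.mem_finsupp_iff]
  refine ⟨hr, fun ℓ _ => Finset.mem_range_succ_iff.mpr ?_⟩
  by_cases h : ℓ ∈ r.support
  · calc r ℓ ≤ r ℓ * a ℓ := Nat.le_mul_of_pos_right _ (ha ℓ)
      _ ≤ r.sum fun ℓ j => j * a ℓ :=
        Finset.single_le_sum (f := fun ℓ => r ℓ * a ℓ) (fun _ _ => Nat.zero_le _) h
      _ = n := hn
  · simp [Finsupp.notMem_support_iff.mp h]

lemma ncard_partReps_zero (a : ℕ → ℕ) (n : ℕ) :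
    (partReps a 0 n).ncard = if n = 0 then 1 else 0 := by
  split_ifs with h
  · have : partReps a 0 n = {0} := by
      ext r
      simp only [partReps, Finset.range_zero, Finset.subset_empty, Finsupp.support_eq_empty,
        Set.mem_ofPred_eq, Set.mem_singleton_iff]
      constructor
      · exact fun h => h.1
      · rintro rfl; simp [h]
    rw [this, Set.ncard_singleton]
  · have : partReps a 0 n = ∅ := by
      ext r
      simp only [partReps, Finset.range_zero, Finset.subset_empty, Finsupp.support_eq_empty,
        Set.mem_ofPred_eq, Set.mem_empty_iff_false, iff_false, not_and]
      rintro rfl h0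
      exact h (by simpa using h0.symm)
    rw [this, Set.ncard_empty]

lemma mem_partReps_add_single {a : ℕ → ℕ} {M n : ℕ} (h : a M ≤ n) (r : ℕ →₀ ℕ) :
    r + Finsupp.single M 1 ∈ partReps a (M + 1) n ↔ r ∈ partReps a (M + 1) (n - a M) := by
  have hsum : ((r + Finsupp.single M 1).sum fun ℓ j => j * a ℓ) =
      (r.sum fun ℓ j => j * a ℓ) + a M := by
    rw [Finsupp.sum_add_index' (by simp) (by intros; ring), Finsupp.sum_single_index (by simp),
      one_mul]
  have hsupp : (r + Finsupp.single M 1).support ⊆ Finset.range (M + 1) ↔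
      r.support ⊆ Finset.range (M + 1) := by
    constructor <;> intro hs ℓ hℓ
    · refine hs ?_
      rw [Finsupp.mem_support_iff] at hℓ ⊢
      simp only [Finsupp.coe_add, Pi.add_apply]
      omega
    · by_cases hM : ℓ = M
      · simp [hM]
      · refine hs ?_
        rw [Finsupp.mem_support_iff] at hℓ ⊢
        simpa [Finsupp.single_apply, Ne.symm hM] using hℓ
  simp only [partReps, Set.mem_ofPred_eq, hsum, hsupp]
  refine and_congr_right fun _ => ?_
  omega

lemma ncard_partReps_succ {a : ℕ → ℕ} (ha : ∀ ℓ, 1 ≤ a ℓ) (M n : ℕ) :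
    (partReps a (M + 1) n).ncard = (partReps a M n).ncard +
      if a M ≤ n then (partReps a (M + 1) (n - a M)).ncard else 0 := by
  have hsub : ∀ r : ℕ →₀ ℕ, r ∈ partReps a M n ↔ r ∈ partReps a (M + 1) n ∧ r M = 0 := by
    intro r
    simp only [partReps, Set.mem_ofPred_eq]
    constructor
    · rintro ⟨h1, h2⟩
      refine ⟨⟨h1.trans (Finset.range_mono (Nat.le_succ M)), h2⟩, ?_⟩
      by_contra h3
      simpa using h1 (Finsupp.mem_support_iff.mpr h3)
    · rintro ⟨⟨h1, h2⟩, h3⟩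
      refine ⟨fun ℓ hℓ => ?_, h2⟩
      have h4 := Finset.mem_range.mp (h1 hℓ)
      have h5 : ℓ ≠ M := by
        rintro rfl
        exact Finsupp.mem_support_iff.mp hℓ h3
      exact Finset.mem_range.mpr (by omega)
  have hge : ∀ r ∈ partReps a (M + 1) n, r M ≠ 0 → a M ≤ n ∧
      ∃ s, s + Finsupp.single M 1 = r := by
    intro r hr hM
    have h1 : Finsupp.single M 1 ≤ r := Finsupp.single_le_iff.mpr (Nat.one_le_iff_ne_zero.mpr hM)
    refine ⟨?_, r - Finsupp.single M 1, tsub_add_cancel_of_le h1⟩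
    calc a M ≤ r M * a M := Nat.le_mul_of_pos_left _ (Nat.pos_of_ne_zero hM)
      _ ≤ r.sum fun ℓ j => j * a ℓ :=
        Finset.single_le_sum (f := fun ℓ => r ℓ * a ℓ) (fun _ _ => Nat.zero_le _)
          (Finsupp.mem_support_iff.mpr hM)
      _ = n := hr.2
  split_ifs with h
  · have hunion : partReps a (M + 1) n = partReps a M n ∪
        (fun r => r + Finsupp.single M 1) '' partReps a (M + 1) (n - a M) := by
      ext r
      rw [Set.mem_union, hsub]
      constructor
      · intro hr
        by_cases hM : r M = 0
        · exact Or.inl ⟨hr, hM⟩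
        · obtain ⟨-, s, rfl⟩ := hge r hr hM
          exact Or.inr ⟨s, (mem_partReps_add_single h s).mp hr, rfl⟩
      · rintro (hr | ⟨s, hs, rfl⟩)
        · exact hr.1
        · exact (mem_partReps_add_single h s).mpr hs
    have hdisj : Disjoint (partReps a M n)
        ((fun r => r + Finsupp.single M 1) '' partReps a (M + 1) (n - a M)) := by
      rw [Set.disjoint_left]
      rintro _ hr ⟨s, -, rfl⟩
      simpa using ((hsub _).mp hr).2
    rw [hunion, Set.ncard_union_eq hdisj (finite_partReps ha _ _)
      ((finite_partReps ha _ _).image _), Set.ncard_image_of_injective _ (add_left_injective _)]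
  · rw [add_zero]
    congr 1
    ext r
    rw [hsub]
    refine ⟨fun hr => ⟨hr, ?_⟩, fun hr => hr.1⟩
    by_contra hM
    exact h (hge r hr hM).1

lemma norm_exp_mul_cexp_lt_one {u : ℝ} (hu : 0 < u) (φ : ℝ) :
    ‖(Real.exp (-u) : ℂ) * Complex.exp (φ * Complex.I)‖ < 1 := by
  rw [norm_mul, Complex.norm_exp_ofReal_mul_I, mul_one, Complex.norm_real, Real.norm_eq_abs,
    abs_of_pos (Real.exp_pos _)]
  exact Real.exp_lt_one_iff.mpr (by linarith)

lemma one_sub_exp_mul_cexp_ne_zero {u : ℝ} (hu : 0 < u) (φ : ℝ) :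
    1 - (Real.exp (-u) : ℂ) * Complex.exp (φ * Complex.I) ≠ 0 := by
  intro h
  have h1 := norm_exp_mul_cexp_lt_one hu φ
  rw [← sub_eq_zero.mp h, norm_one] at h1
  exact lt_irrefl _ h1

/-- The generating function of partitions into the first `M` parts, at `e^{-x + iθ}`. -/
noncomputable def partGen (a : ℕ → ℕ) (x : ℝ) (M : ℕ) (θ : ℝ) : ℂ :=
  ∏ ℓ ∈ Finset.range M,
    (1 - (Real.exp (-(x * a ℓ)) : ℂ) * Complex.exp (((a ℓ * θ : ℝ) : ℂ) * Complex.I))⁻¹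

lemma continuous_partGen {a : ℕ → ℕ} (ha : ∀ ℓ, 1 ≤ a ℓ) {x : ℝ} (hx : 0 < x) (M : ℕ) :
    Continuous (partGen a x M) := by
  refine continuous_finsetProd _ fun ℓ _ => Continuous.inv₀ (by fun_prop) fun θ => ?_
  exact one_sub_exp_mul_cexp_ne_zero (mul_pos hx (by exact_mod_cast ha ℓ)) _

lemma integral_cexp_neg_int_mul (n : ℤ) :
    ∫ θ in (-π)..π, Complex.exp (-(n * θ * Complex.I)) = if n = 0 then 2 * (π : ℂ) else 0 := by
  split_ifs with h
  · simp [h]; ring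
  · have hc : -((n : ℂ) * Complex.I) ≠ 0 := by simp [h]
    have h1 : ∀ θ : ℝ, Complex.exp (-(n * θ * Complex.I)) =
        Complex.exp (-((n : ℂ) * Complex.I) * θ) := fun θ => by congr 1; ring
    simp_rw [h1]
    rw [integral_exp_mul_complex hc, div_eq_zero_iff, sub_eq_zero]
    left
    rw [Complex.exp_eq_exp_iff_exists_int]
    refine ⟨-n, ?_⟩
    push_cast; ring

/-- Fourier coefficients of `partGen`. -/
noncomputable def partCoeff (a : ℕ → ℕ) (x : ℝ) (M : ℕ) (n : ℤ) : ℂ :=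
  ∫ θ in (-π)..π, partGen a x M θ * Complex.exp (-(n * θ * Complex.I))

lemma partCoeff_succ {a : ℕ → ℕ} (ha : ∀ ℓ, 1 ≤ a ℓ) {x : ℝ} (hx : 0 < x) (M : ℕ) (n : ℤ) :
    partCoeff a x (M + 1) n = partCoeff a x M n +
      Real.exp (-(x * a M)) * partCoeff a x (M + 1) (n - a M) := by
  have hcont : ∀ (M : ℕ) (n : ℤ), Continuous fun θ : ℝ =>
      partGen a x M θ * Complex.exp (-(n * θ * Complex.I)) := fun M n =>
    (continuous_partGen ha hx M).mul (by fun_prop)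
  rw [partCoeff, partCoeff, partCoeff, ← intervalIntegral.integral_const_mul,
    ← intervalIntegral.integral_add ((hcont _ _).intervalIntegrable _ _)
      (((hcont _ _).intervalIntegrable _ _).const_mul _)]
  refine intervalIntegral.integral_congr fun θ _ => ?_
  have hne := one_sub_exp_mul_cexp_ne_zero (mul_pos hx (Nat.cast_pos.mpr (ha M))) (a M * θ)
  have hexp : Complex.exp (-(((n - a M : ℤ) : ℂ) * θ * Complex.I)) =
      Complex.exp (-(n * θ * Complex.I)) * Complex.exp (((a M * θ : ℝ) : ℂ) * Complex.I) := by
    rw [← Complex.exp_add]; congr 1; push_cast; ring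
  rw [hexp, partGen, Finset.prod_range_succ, ← partGen]
  field_simp
  ring

lemma exists_norm_partCoeff_le (a : ℕ → ℕ) (x : ℝ) (M : ℕ) :
    ∃ B, ∀ n, ‖partCoeff a x M n‖ ≤ B := by
  refine ⟨∫ θ in (-π)..π, ‖partGen a x M θ‖, fun n => ?_⟩
  refine (intervalIntegral.norm_integral_le_integral_norm (by linarith [pi_pos])).trans_eq ?_
  refine intervalIntegral.integral_congr fun θ _ => ?_
  have : -((n : ℂ) * θ * Complex.I) = ((-(n * θ) : ℝ) : ℂ) * Complex.I := by push_cast; ring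
  simp only [norm_mul]
  rw [this, Complex.norm_exp_ofReal_mul_I, mul_one]

lemma partCoeff_of_neg {a : ℕ → ℕ} (ha : ∀ ℓ, 1 ≤ a ℓ) {x : ℝ} (hx : 0 < x) (M : ℕ) :
    ∀ n < 0, partCoeff a x M n = 0 := by
  induction M with
  | zero =>
    intro n hn
    simp [partCoeff, partGen, integral_cexp_neg_int_mul, hn.ne]
  | succ M ih =>
    intro n hn
    obtain ⟨B, hB⟩ := exists_norm_partCoeff_le a x (M + 1)
    set q := Real.exp (-(x * a M))
    have hq1 : q < 1 := by
      have := mul_pos hx (Nat.cast_pos (α := ℝ).mpr (ha M))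
      exact Real.exp_lt_one_iff.mpr (by linarith)
    have hq0 : 0 < q := Real.exp_pos _
    have hiter : ∀ k : ℕ, ∀ n < 0, ‖partCoeff a x (M + 1) n‖ ≤ q ^ k * B := by
      intro k
      induction k with
      | zero => intro n _; simpa using hB n
      | succ k ihk =>
        intro n hn
        rw [partCoeff_succ ha hx, ih n hn, zero_add, norm_mul, Complex.norm_real,
          Real.norm_eq_abs, abs_of_pos hq0, pow_succ', mul_assoc]
        exact mul_le_mul_of_nonneg_left (ihk _ (by omega)) hq0.le
    have hlim : Tendsto (fun k : ℕ => q ^ k * B) atTop (𝓝 0) := by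
      simpa using (tendsto_pow_atTop_nhds_zero_of_lt_one hq0.le hq1).mul_const B
    exact norm_le_zero_iff.mp (ge_of_tendsto' hlim fun k => hiter k n hn)

lemma partCoeff_eq_ncard {a : ℕ → ℕ} (ha : ∀ ℓ, 1 ≤ a ℓ) {x : ℝ} (hx : 0 < x) (M n : ℕ) :
    partCoeff a x M n = 2 * π * (partReps a M n).ncard * Real.exp (-(n * x)) := by
  induction M generalizing n with
  | zero =>
    rw [ncard_partReps_zero]
    by_cases h : n = 0
    · simp [partCoeff, partGen, h]; ring
    · have h1 := integral_cexp_neg_int_mul (n : ℤ)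
      rw [if_neg (by exact_mod_cast h)] at h1
      simp only [partCoeff, partGen, Finset.range_zero, Finset.prod_empty, one_mul]
      rw [h1]; simp [h]
  | succ M ih =>
    induction n using Nat.strong_induction_on with
    | _ n ihn =>
      rw [partCoeff_succ ha hx, ih, ncard_partReps_succ ha]
      split_ifs with h
      · have h1 : (n : ℤ) - a M = ((n - a M : ℕ) : ℤ) := by omega
        have h2 : Real.exp (-(n * x)) =
            Real.exp (-(x * a M)) * Real.exp (-(((n - a M : ℕ) : ℝ) * x)) := by
          rw [← Real.exp_add, Nat.cast_sub h]; congr 1; ring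
        rw [h1, ihn (n - a M) (by have := ha M; omega), h2]
        push_cast; ring
      · rw [partCoeff_of_neg ha hx (M + 1) _ (by omega)]
        simp

lemma HasPowerGrowth.exists_partReps_eq {κ : ℝ} {a : ℕ → ℕ} (ha : HasPowerGrowth κ a)
    (hκ : 0 < κ) (n : ℕ) : ∃ M₀, ∀ M ≥ M₀,
      partReps a M n = {r | (r.sum fun ℓ j => j * a ℓ) = n} := by
  have hlim : Tendsto (fun ℓ : ℕ => ((ℓ : ℝ) + 1) ^ κ) atTop atTop :=
    (tendsto_rpow_atTop hκ).comp (tendsto_natCast_atTop_atTop.atTop_add tendsto_const_nhds)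
  obtain ⟨M₀, h⟩ := eventually_atTop.mp (hlim.eventually (eventually_gt_atTop (2 * n : ℝ)))
  refine ⟨M₀, fun M hM => ?_⟩
  ext r
  refine ⟨fun hr => hr.2, fun hr => ⟨fun ℓ hℓ => ?_, hr⟩⟩
  rw [Finset.mem_range]
  by_contra! hle
  have h1 := (h ℓ (hM.le.trans hle)).trans_le (ha.rpow_le ℓ)
  have h2 : n < a ℓ := by
    have : (n : ℝ) < a ℓ := by linarith
    exact_mod_cast this
  have h3 : a ℓ ≤ n := by
    calc a ℓ ≤ r ℓ * a ℓ :=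
        Nat.le_mul_of_pos_left _ (Nat.pos_of_ne_zero (Finsupp.mem_support_iff.mp hℓ))
      _ ≤ r.sum fun ℓ j => j * a ℓ :=
        Finset.single_le_sum (f := fun ℓ => r ℓ * a ℓ) (fun _ _ => Nat.zero_le _) hℓ
      _ = n := hr
  omega

/-! ### The logarithm of the characteristic function -/

/-- The Bose factor at the complex argument `u - iφ`. -/
noncomputable def boseC (u φ : ℝ) : ℂ :=
  (Real.exp (-u) : ℂ) * Complex.exp (φ * Complex.I) /
    (1 - (Real.exp (-u) : ℂ) * Complex.exp (φ * Complex.I))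

/-- The logarithm of `(1 - e^{-u}) / (1 - e^{-u + iφ})`. -/
noncomputable def logRatio (u φ : ℝ) : ℂ :=
  (Real.log (1 - Real.exp (-u)) : ℂ) -
    Complex.log (1 - (Real.exp (-u) : ℂ) * Complex.exp (φ * Complex.I))

lemma one_sub_exp_le_norm {u : ℝ} (φ : ℝ) :
    1 - Real.exp (-u) ≤ ‖1 - (Real.exp (-u) : ℂ) * Complex.exp (φ * Complex.I)‖ := by
  have h := norm_sub_norm_le (1 : ℂ) ((Real.exp (-u) : ℂ) * Complex.exp (φ * Complex.I))
  rwa [norm_mul, Complex.norm_exp_ofReal_mul_I, mul_one, Complex.norm_real, Real.norm_eq_abs,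
    abs_of_pos (Real.exp_pos _), norm_one] at h

lemma norm_boseC_le {u : ℝ} (hu : 0 < u) (φ : ℝ) : ‖boseC u φ‖ ≤ bose u := by
  have h1 : Real.exp (-u) < 1 := Real.exp_lt_one_iff.mpr (by linarith)
  rw [bose_eq_exp_neg_div hu, boseC, norm_div, norm_mul, Complex.norm_exp_ofReal_mul_I, mul_one,
    Complex.norm_real, Real.norm_eq_abs, abs_of_pos (Real.exp_pos _)]
  exact div_le_div_of_nonneg_left (Real.exp_pos _).le (by linarith) (one_sub_exp_le_norm φ)

lemma boseC_zero {u : ℝ} (hu : 0 < u) : boseC u 0 = bose u := by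
  rw [bose_eq_exp_neg_div hu, boseC]; simp

lemma logRatio_zero {u : ℝ} (hu : 0 < u) : logRatio u 0 = 0 := by
  have h1 : Real.exp (-u) < 1 := Real.exp_lt_one_iff.mpr (by linarith)
  rw [logRatio, Complex.ofReal_log (by linarith)]; simp

lemma hasDerivAt_exp_mul_cexp (u φ : ℝ) :
    HasDerivAt (fun t : ℝ => (Real.exp (-u) : ℂ) * Complex.exp (t * Complex.I))
      (Complex.I * ((Real.exp (-u) : ℂ) * Complex.exp (φ * Complex.I))) φ := by
  have := ((Complex.ofRealCLM.hasDerivAt (x := φ)).mul_const Complex.I).cexp.const_mul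
    (Real.exp (-u) : ℂ)
  refine this.congr_deriv ?_
  simp; ring

lemma hasDerivAt_boseC {u : ℝ} (hu : 0 < u) (φ : ℝ) :
    HasDerivAt (boseC u) (Complex.I * (boseC u φ + boseC u φ ^ 2)) φ := by
  have hne := one_sub_exp_mul_cexp_ne_zero hu φ
  have h := hasDerivAt_exp_mul_cexp u φ
  refine (h.div (h.const_sub 1) hne).congr_deriv ?_
  rw [boseC]
  generalize (Real.exp (-u) : ℂ) * Complex.exp (φ * Complex.I) = w at *
  field_simp
  ring

lemma hasDerivAt_logRatio {u : ℝ} (hu : 0 < u) (φ : ℝ) :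
    HasDerivAt (logRatio u) (Complex.I * boseC u φ) φ := by
  have hne := one_sub_exp_mul_cexp_ne_zero hu φ
  have hlt := norm_exp_mul_cexp_lt_one hu φ
  have h := (hasDerivAt_exp_mul_cexp u φ).const_sub 1
  have hslit : 1 - (Real.exp (-u) : ℂ) * Complex.exp (φ * Complex.I) ∈ Complex.slitPlane := by
    refine Or.inl ?_
    rw [Complex.sub_re, Complex.one_re]
    linarith [Complex.re_le_norm ((Real.exp (-u) : ℂ) * Complex.exp (φ * Complex.I))]
  refine ((h.clog_real hslit).const_sub _).congr_deriv ?_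
  rw [boseC]
  ring

lemma norm_le_mul_abs_pow_succ {F F' : ℝ → ℂ} {C : ℝ} {k : ℕ} (hC : 0 ≤ C) (h0 : F 0 = 0)
    (hF : ∀ t, HasDerivAt F (F' t) t) (hF' : ∀ t, ‖F' t‖ ≤ C * |t| ^ k) (t : ℝ) :
    ‖F t‖ ≤ C * |t| ^ (k + 1) := by
  have h := (convex_uIcc 0 t).norm_image_sub_le_of_norm_hasDerivWithin_le (f := F) (f' := F')
    (C := C * |t| ^ k) (fun s _ => (hF s).hasDerivWithinAt) (fun s hs => ?_)
    Set.left_mem_uIcc Set.right_mem_uIcc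
  · rw [h0, sub_zero, sub_zero, Real.norm_eq_abs, mul_assoc, ← pow_succ] at h
    exact h
  · refine (hF' s).trans ?_
    have : |s| ≤ |t| := by simpa using Set.abs_sub_left_of_mem_uIcc hs
    gcongr

lemma norm_logRatio_le {u : ℝ} (hu : 0 < u) (φ : ℝ) : ‖logRatio u φ‖ ≤ bose u * |φ| := by
  have := norm_le_mul_abs_pow_succ (k := 0) (bose_pos hu).le (logRatio_zero hu)
    (hasDerivAt_logRatio hu) (fun t => by
      rw [norm_mul, Complex.norm_I, one_mul, pow_zero, mul_one]; exact norm_boseC_le hu t) φ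
  simpa using this

/-- The remainder of the quadratic Taylor expansion of `logRatio`. -/
noncomputable def logRatioRem (u φ : ℝ) : ℂ :=
  logRatio u φ - Complex.I * bose u * φ + (bose u + bose u ^ 2 : ℝ) * (φ : ℂ) ^ 2 / 2

lemma hasDerivAt_ofReal_pow (k : ℕ) (t : ℝ) :
    HasDerivAt (fun s : ℝ => (s : ℂ) ^ (k + 1)) ((k + 1) * (t : ℂ) ^ k) t := by
  have := (Complex.ofRealCLM.hasDerivAt (x := t)).pow (k + 1)
  refine this.congr_deriv ?_
  simp

lemma hasDerivAt_logRatioRem {u : ℝ} (hu : 0 < u) (t : ℝ) :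
    HasDerivAt (logRatioRem u) (Complex.I * boseC u t - Complex.I * bose u +
      (bose u + bose u ^ 2 : ℝ) * (t : ℂ)) t := by
  have h1 := (hasDerivAt_ofReal_pow 0 t).const_mul (Complex.I * bose u)
  have h2 := ((hasDerivAt_ofReal_pow 1 t).const_mul ((bose u + bose u ^ 2 : ℝ) : ℂ)).div_const 2
  refine HasDerivAt.congr_deriv (f' := _) (((hasDerivAt_logRatio hu t).sub h1).add h2)
    (by push_cast; ring) |>.congr_of_eventuallyEq (Eventually.of_forall fun s => ?_)
  simp [logRatioRem]

lemma hasDerivAt_deriv_logRatioRem {u : ℝ} (hu : 0 < u) (t : ℝ) :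
    HasDerivAt (fun t : ℝ => Complex.I * boseC u t - Complex.I * bose u +
      (bose u + bose u ^ 2 : ℝ) * (t : ℂ))
      (-(boseC u t + boseC u t ^ 2) + (bose u + bose u ^ 2 : ℝ)) t := by
  have h1 := (hasDerivAt_ofReal_pow 0 t).const_mul ((bose u + bose u ^ 2 : ℝ) : ℂ)
  refine HasDerivAt.congr_deriv (f' := _)
    ((((hasDerivAt_boseC hu t).const_mul Complex.I).sub_const (Complex.I * bose u)).add h1)
    ?_ |>.congr_of_eventuallyEq (Eventually.of_forall fun s => ?_)
  · rw [← mul_assoc, Complex.I_mul_I]; push_cast; ring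
  · simp

lemma hasDerivAt_deriv_deriv_logRatioRem {u : ℝ} (hu : 0 < u) (t : ℝ) :
    HasDerivAt (fun t : ℝ => -(boseC u t + boseC u t ^ 2) + ((bose u + bose u ^ 2 : ℝ) : ℂ))
      (-(Complex.I * ((1 + 2 * boseC u t) * (boseC u t + boseC u t ^ 2)))) t := by
  have h := hasDerivAt_boseC hu t
  refine ((h.add (h.pow 2)).neg.add_const _).congr_deriv ?_
  push_cast; ring

lemma logRatioRem_zero {u : ℝ} (hu : 0 < u) : logRatioRem u 0 = 0 := by
  simp [logRatioRem, logRatio_zero hu]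

lemma norm_logRatioRem_le {u : ℝ} (hu : 0 < u) (φ : ℝ) :
    ‖logRatioRem u φ‖ ≤ (1 + 2 * bose u) * (bose u + bose u ^ 2) * |φ| ^ 3 := by
  have hb := bose_pos hu
  set P := (1 + 2 * bose u) * (bose u + bose u ^ 2)
  have hP : 0 ≤ P := by positivity
  have h2 := norm_le_mul_abs_pow_succ (k := 0) hP (by simp [boseC_zero hu])
    (hasDerivAt_deriv_deriv_logRatioRem hu) (fun t => by
      have := norm_boseC_le hu t
      rw [norm_neg, norm_mul, Complex.norm_I, one_mul, pow_zero, mul_one, norm_mul]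
      have e1 : ‖1 + 2 * boseC u t‖ ≤ 1 + 2 * bose u := (norm_add_le _ _).trans (by
        rw [norm_one, norm_mul, Complex.norm_ofNat]; linarith)
      have e2 : ‖boseC u t + boseC u t ^ 2‖ ≤ bose u + bose u ^ 2 := (norm_add_le _ _).trans (by
        rw [norm_pow]; gcongr)
      exact mul_le_mul e1 e2 (norm_nonneg _) (by positivity))
  have h1 := norm_le_mul_abs_pow_succ hP (by simp [boseC_zero hu])
    (hasDerivAt_deriv_logRatioRem hu) h2
  exact norm_le_mul_abs_pow_succ hP (logRatioRem_zero hu) (hasDerivAt_logRatioRem hu) h1 φ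

lemma abs_re_logRatioRem_le {u : ℝ} (hu : 0 < u) (φ : ℝ) :
    |(logRatioRem u φ).re| ≤
      (1 + 6 * bose u + 6 * bose u ^ 2) * (bose u + bose u ^ 2) * |φ| ^ 4 := by
  have hb := bose_pos hu
  set P := (1 + 6 * bose u + 6 * bose u ^ 2) * (bose u + bose u ^ 2)
  have hP : 0 ≤ P := by positivity
  obtain ⟨c, hc⟩ : ∃ c : ℂ, c = ((1 + 2 * bose u) * (bose u + bose u ^ 2) : ℝ) := ⟨_, rfl⟩
  have d3 : ∀ t : ℝ, HasDerivAt (fun t : ℝ =>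
      -(Complex.I * ((1 + 2 * boseC u t) * (boseC u t + boseC u t ^ 2))) + Complex.I * c)
      ((1 + 6 * boseC u t + 6 * boseC u t ^ 2) * (boseC u t + boseC u t ^ 2)) t := fun t => by
    have h := hasDerivAt_boseC hu t
    refine ((((((h.const_mul 2).const_add 1).mul (h.add (h.pow 2))).const_mul
      Complex.I).neg).add_const _).congr_deriv ?_
    simp only [Pi.add_apply, Pi.pow_apply]
    linear_combination (-(1 + 6 * boseC u t + 6 * boseC u t ^ 2) *
      (boseC u t + boseC u t ^ 2)) * Complex.I_mul_I
  have h3 := norm_le_mul_abs_pow_succ (k := 0) hP (by simp [boseC_zero hu, hc])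
    d3 (fun t => by
      have := norm_boseC_le hu t
      rw [pow_zero, mul_one, norm_mul]
      have e1 : ‖1 + 6 * boseC u t + 6 * boseC u t ^ 2‖ ≤ 1 + 6 * bose u + 6 * bose u ^ 2 := by
        refine (norm_add_le _ _).trans (add_le_add ((norm_add_le _ _).trans ?_) ?_)
        · rw [norm_one, norm_mul, Complex.norm_ofNat]; linarith
        · rw [norm_mul, Complex.norm_ofNat, norm_pow]; gcongr
      have e2 : ‖boseC u t + boseC u t ^ 2‖ ≤ bose u + bose u ^ 2 := (norm_add_le _ _).trans (by
        rw [norm_pow]; gcongr)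
      exact mul_le_mul e1 e2 (norm_nonneg _) (by positivity))
  have d2 : ∀ t : ℝ, HasDerivAt (fun t : ℝ =>
      -(boseC u t + boseC u t ^ 2) + ((bose u + bose u ^ 2 : ℝ) : ℂ) +
        Complex.I * c * (t : ℂ) ^ (0 + 1))
      (-(Complex.I * ((1 + 2 * boseC u t) * (boseC u t + boseC u t ^ 2))) + Complex.I * c) t :=
    fun t =>
    ((hasDerivAt_deriv_deriv_logRatioRem hu t).add
      ((hasDerivAt_ofReal_pow 0 t).const_mul (Complex.I * c))).congr_deriv
      (by push_cast; ring)
  have h2 := norm_le_mul_abs_pow_succ hP (by simp [boseC_zero hu]) d2 h3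
  have d1 : ∀ t : ℝ, HasDerivAt (fun t : ℝ => Complex.I * boseC u t - Complex.I * bose u +
      (bose u + bose u ^ 2 : ℝ) * (t : ℂ) + Complex.I * c / 2 * (t : ℂ) ^ (1 + 1))
      (-(boseC u t + boseC u t ^ 2) + ((bose u + bose u ^ 2 : ℝ) : ℂ) +
        Complex.I * c * (t : ℂ) ^ (0 + 1)) t := fun t =>
    ((hasDerivAt_deriv_logRatioRem hu t).add
      ((hasDerivAt_ofReal_pow 1 t).const_mul (Complex.I * c / 2))).congr_deriv
      (by push_cast; ring)
  have h1 := norm_le_mul_abs_pow_succ hP (by simp [boseC_zero hu]) d1 h2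
  have d0 : ∀ t : ℝ, HasDerivAt (fun t : ℝ => logRatioRem u t +
      Complex.I * c / 6 * (t : ℂ) ^ (2 + 1))
      (Complex.I * boseC u t - Complex.I * bose u +
      (bose u + bose u ^ 2 : ℝ) * (t : ℂ) + Complex.I * c / 2 * (t : ℂ) ^ (1 + 1)) t := fun t =>
    ((hasDerivAt_logRatioRem hu t).add
      ((hasDerivAt_ofReal_pow 2 t).const_mul (Complex.I * c / 6))).congr_deriv
      (by push_cast; ring)
  have h0 := norm_le_mul_abs_pow_succ hP (by simp [logRatioRem_zero hu]) d0 h1 φ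
  refine le_trans (le_of_eq ?_) ((Complex.abs_re_le_norm _).trans h0)
  have : Complex.I * c / 6 * (φ : ℂ) ^ (2 + 1) =
      (((1 + 2 * bose u) * (bose u + bose u ^ 2) / 6 * φ ^ 3 : ℝ) : ℂ) * Complex.I := by
    rw [hc]; push_cast; ring
  rw [this, Complex.add_re, Complex.re_ofReal_mul, Complex.I_re, mul_zero, add_zero]

lemma exp_logRatio {u : ℝ} (hu : 0 < u) (φ : ℝ) :
    Complex.exp (logRatio u φ) = ((1 - Real.exp (-u) : ℝ) : ℂ) *
      (1 - (Real.exp (-u) : ℂ) * Complex.exp (φ * Complex.I))⁻¹ := by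
  have h1 : Real.exp (-u) < 1 := Real.exp_lt_one_iff.mpr (by linarith)
  rw [logRatio, Complex.exp_sub, Complex.exp_log (one_sub_exp_mul_cexp_ne_zero hu φ),
    ← Complex.ofReal_exp, Real.exp_log (by linarith), div_eq_mul_inv]

lemma norm_exp_logRatio {u : ℝ} (hu : 0 < u) (φ : ℝ) :
    ‖Complex.exp (logRatio u φ)‖ = (1 - Real.exp (-u)) /
      ‖1 - (Real.exp (-u) : ℂ) * Complex.exp (φ * Complex.I)‖ := by
  have h1 : Real.exp (-u) < 1 := Real.exp_lt_one_iff.mpr (by linarith)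
  rw [exp_logRatio hu, norm_mul, norm_inv, Complex.norm_real, Real.norm_eq_abs,
    abs_of_pos (by linarith), div_eq_mul_inv]

lemma norm_exp_logRatio_le_one {u : ℝ} (hu : 0 < u) (φ : ℝ) :
    ‖Complex.exp (logRatio u φ)‖ ≤ 1 := by
  rw [norm_exp_logRatio hu]
  exact div_le_one_of_le₀ (one_sub_exp_le_norm φ) (norm_nonneg _)

lemma re_logRatio_nonpos {u : ℝ} (hu : 0 < u) (φ : ℝ) : (logRatio u φ).re ≤ 0 := by
  have := norm_exp_logRatio_le_one hu φ
  rwa [Complex.norm_exp, Real.exp_le_one_iff] at this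

/-- The logarithm of the normalised generating function of partitions with parts in `a`,
evaluated at `e^{-x + iθ}`. -/
noncomputable def logChar (a : ℕ → ℕ) (x θ : ℝ) : ℂ := ∑' ℓ, logRatio (x * a ℓ) (a ℓ * θ)

lemma HasPowerGrowth.norm_logRatio_mul_le {κ : ℝ} {a : ℕ → ℕ} (ha : HasPowerGrowth κ a)
    {x : ℝ} (hx : 0 < x) (θ : ℝ) (ℓ : ℕ) :
    ‖logRatio (x * a ℓ) (a ℓ * θ)‖ ≤ (a ℓ : ℝ) * bose (x * a ℓ) * |θ| := by
  refine (norm_logRatio_le (mul_pos hx (ha.cast_pos ℓ)) _).trans_eq ?_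
  rw [abs_mul, abs_of_pos (ha.cast_pos ℓ)]; ring

lemma HasPowerGrowth.summable_logRatio {κ : ℝ} {a : ℕ → ℕ} (ha : HasPowerGrowth κ a)
    (hκ : 0 < κ) {x : ℝ} (hx : 0 < x) (θ : ℝ) :
    Summable fun ℓ => logRatio (x * a ℓ) (a ℓ * θ) :=
  .of_norm_bounded ((ha.summable_boseMean hκ hx).mul_right |θ|)
    fun ℓ => ha.norm_logRatio_mul_le hx θ ℓ

lemma HasPowerGrowth.continuousOn_logChar {κ : ℝ} {a : ℕ → ℕ} (ha : HasPowerGrowth κ a)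
    (hκ : 0 < κ) {x : ℝ} (hx : 0 < x) : ContinuousOn (logChar a x) (Set.Icc (-π) π) := by
  refine continuousOn_tsum (u := fun ℓ => (a ℓ : ℝ) * bose (x * a ℓ) * π) (fun ℓ => ?_)
    ((ha.summable_boseMean hκ hx).mul_right π) fun ℓ θ hθ => ?_
  · have h : Continuous (logRatio (x * a ℓ)) := continuous_iff_continuousAt.mpr fun t =>
      (hasDerivAt_logRatio (mul_pos hx (ha.cast_pos ℓ)) t).continuousAt
    exact (h.comp (continuous_const.mul continuous_id)).continuousOn
  · have hb := bose_pos (mul_pos hx (ha.cast_pos ℓ))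
    have := ha.cast_pos ℓ
    refine (ha.norm_logRatio_mul_le hx θ ℓ).trans ?_
    have : |θ| ≤ π := abs_le.mpr hθ
    gcongr

lemma HasPowerGrowth.norm_exp_logChar_le_prod {κ : ℝ} {a : ℕ → ℕ} (ha : HasPowerGrowth κ a)
    (hκ : 0 < κ) {x : ℝ} (hx : 0 < x) (θ : ℝ) (S : Finset ℕ) :
    ‖Complex.exp (logChar a x θ)‖ ≤
      ∏ ℓ ∈ S, ‖Complex.exp (logRatio (x * a ℓ) (a ℓ * θ))‖ := by
  have hs := ha.summable_logRatio hκ hx θ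
  simp only [Complex.norm_exp]
  rw [← Real.exp_sum, Real.exp_le_exp, logChar, Complex.re_tsum hs]
  have := ((Complex.hasSum_re hs.hasSum).summable.neg).sum_le_tsum S fun ℓ _ =>
    neg_nonneg.mpr (re_logRatio_nonpos (mul_pos hx (ha.cast_pos ℓ)) (a ℓ * θ))
  rw [tsum_neg, Finset.sum_neg_distrib] at this
  linarith

lemma HasPowerGrowth.summable_log_one_sub {κ : ℝ} {a : ℕ → ℕ} (ha : HasPowerGrowth κ a)
    (hκ : 0 < κ) {x : ℝ} (hx : 0 < x) :
    Summable fun ℓ => Real.log (1 - Real.exp (-(x * a ℓ))) :=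
  .of_norm_bounded (ha.summable_bose hκ hx) fun ℓ =>
    abs_log_one_sub_exp_le (mul_pos hx (ha.cast_pos ℓ))

lemma HasPowerGrowth.prod_mul_partGen {κ : ℝ} {a : ℕ → ℕ} (ha : HasPowerGrowth κ a)
    {x : ℝ} (hx : 0 < x) (M : ℕ) (θ : ℝ) :
    (Real.exp (∑ ℓ ∈ Finset.range M, Real.log (1 - Real.exp (-(x * a ℓ)))) : ℂ) *
      partGen a x M θ = Complex.exp (∑ ℓ ∈ Finset.range M, logRatio (x * a ℓ) (a ℓ * θ)) := by
  rw [Real.exp_sum, Complex.exp_sum, partGen, Complex.ofReal_prod, ← Finset.prod_mul_distrib]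
  refine Finset.prod_congr rfl fun ℓ _ => ?_
  have hu := mul_pos hx (ha.cast_pos ℓ)
  have h1 : Real.exp (-(x * a ℓ)) < 1 := Real.exp_lt_one_iff.mpr (by linarith)
  rw [exp_logRatio hu, Real.exp_log (by linarith)]

lemma HasPowerGrowth.card_mul_exp_eq_integral {κ : ℝ} {a : ℕ → ℕ} (ha : HasPowerGrowth κ a)
    (hκ : 0 < κ) {x : ℝ} (hx : 0 < x) (n : ℕ) :
    ((2 * π * Nat.card {r : ℕ →₀ ℕ // (r.sum fun ℓ j => j * a ℓ) = n} * Real.exp (-(n * x)) *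
      Real.exp (∑' ℓ, Real.log (1 - Real.exp (-(x * a ℓ)))) : ℝ) : ℂ) =
      ∫ θ in (-π)..π, Complex.exp (logChar a x θ) * Complex.exp (-(n * θ * Complex.I)) := by
  obtain ⟨M₀, hM₀⟩ := ha.exists_partReps_eq hκ n
  set D : ℕ → ℝ := fun M =>
    Real.exp (∑ ℓ ∈ Finset.range M, Real.log (1 - Real.exp (-(x * a ℓ))))
  have hD : Tendsto (fun M => (D M : ℂ)) atTop
      (𝓝 (Real.exp (∑' ℓ, Real.log (1 - Real.exp (-(x * a ℓ)))) : ℂ)) :=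
    (Complex.continuous_ofReal.tendsto _).comp ((Real.continuous_exp.tendsto _).comp
      (ha.summable_log_one_sub hκ hx).hasSum.tendsto_sum_nat)
  have hleft := hD.const_mul ((2 * π * Nat.card {r : ℕ →₀ ℕ // (r.sum fun ℓ j => j * a ℓ) = n} *
    Real.exp (-(n * x)) : ℝ) : ℂ)
  have hright : Tendsto (fun M => ∫ θ in (-π)..π,
      (D M : ℂ) * partGen a x M θ * Complex.exp (-(n * θ * Complex.I))) atTop
      (𝓝 (∫ θ in (-π)..π, Complex.exp (logChar a x θ) * Complex.exp (-(n * θ * Complex.I)))) := by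
    refine intervalIntegral.tendsto_integral_filter_of_dominated_convergence (fun _ => 1)
      (Eventually.of_forall fun M => ?_) (Eventually.of_forall fun M => ?_)
      intervalIntegrable_const ?_
    · have := continuous_partGen ha.one_le hx M
      exact Continuous.aestronglyMeasurable (by fun_prop)
    · refine .of_forall fun θ _ => ?_
      have h1 : ‖Complex.exp (-(n * θ * Complex.I))‖ = 1 := by
        rw [show (-(n * θ * Complex.I) : ℂ) = ((-(n * θ) : ℝ) : ℂ) * Complex.I by push_cast; ring]
        exact Complex.norm_exp_ofReal_mul_I _
      rw [norm_mul, h1, mul_one, ha.prod_mul_partGen hx, Complex.exp_sum, norm_prod]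
      exact Finset.prod_le_one (fun _ _ => norm_nonneg _) fun ℓ _ =>
        norm_exp_logRatio_le_one (mul_pos hx (ha.cast_pos ℓ)) _
    · refine .of_forall fun θ _ => Tendsto.mul_const _ ?_
      simp only [D, ha.prod_mul_partGen hx]
      exact (Complex.continuous_exp.tendsto _).comp
        (ha.summable_logRatio hκ hx θ).hasSum.tendsto_sum_nat
  refine tendsto_nhds_unique ((hleft.congr' ?_).trans (le_of_eq ?_)) hright
  · filter_upwards [eventually_ge_atTop M₀] with M hM
    have h := partCoeff_eq_ncard ha.one_le hx M n
    rw [hM₀ M hM, ← Nat.card_coe_set_eq, partCoeff] at h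
    simp only [mul_assoc (D M : ℂ), intervalIntegral.integral_const_mul]
    rw [mul_comm]
    congr 1
    push_cast at h ⊢
    exact h.symm
  · push_cast; rfl

lemma HasPowerGrowth.exists_logChar_eq {κ : ℝ} {a : ℕ → ℕ} (ha : HasPowerGrowth κ a)
    (hκ : 0 < κ) : ∃ C ≥ 1, ∀ x > 0, ∀ θ : ℝ, ∃ E : ℂ,
      logChar a x θ = Complex.I * boseMean a x * θ - boseVar a x * (θ : ℂ) ^ 2 / 2 + E ∧
      ‖E‖ ≤ C * x ^ (-κ⁻¹ - 3) * |θ| ^ 3 ∧ |E.re| ≤ C * x ^ (-κ⁻¹ - 4) * |θ| ^ 4 := by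
  obtain ⟨C, hC, h⟩ := ha.exists_tsum_pow_mul_bose_pow_le hκ
  refine ⟨26 * C + 1, by linarith, fun x hx θ => ⟨∑' ℓ, logRatioRem (x * a ℓ) (a ℓ * θ), ?_⟩⟩
  have hu : ∀ ℓ, 0 < x * a ℓ := fun ℓ => mul_pos hx (ha.cast_pos ℓ)
  have h3 : ∀ i, 1 ≤ i → i ≤ 3 →
      Summable (fun ℓ => (a ℓ : ℝ) ^ 3 * bose (x * a ℓ) ^ i) ∧
      ∑' ℓ, (a ℓ : ℝ) ^ 3 * bose (x * a ℓ) ^ i ≤ C * x ^ (-κ⁻¹ - 3) := fun i h1 h2 => by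
    simpa using h x hx i 3 h1 h2 (by norm_num)
  have h4 : ∀ i, 1 ≤ i → i ≤ 4 →
      Summable (fun ℓ => (a ℓ : ℝ) ^ 4 * bose (x * a ℓ) ^ i) ∧
      ∑' ℓ, (a ℓ : ℝ) ^ 4 * bose (x * a ℓ) ^ i ≤ C * x ^ (-κ⁻¹ - 4) := fun i h1 h2 => by
    simpa using h x hx i 4 h1 h2 (by norm_num)
  obtain ⟨s31, t31⟩ := h3 1 (by norm_num) (by norm_num)
  obtain ⟨s32, t32⟩ := h3 2 (by norm_num) (by norm_num)
  obtain ⟨s33, t33⟩ := h3 3 (by norm_num) (by norm_num)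
  obtain ⟨s41, t41⟩ := h4 1 (by norm_num) (by norm_num)
  obtain ⟨s42, t42⟩ := h4 2 (by norm_num) (by norm_num)
  obtain ⟨s43, t43⟩ := h4 3 (by norm_num) (by norm_num)
  obtain ⟨s44, t44⟩ := h4 4 (by norm_num) (by norm_num)
  have H3 := (((s31.hasSum.add (s32.hasSum.mul_left 3)).add (s33.hasSum.mul_left 2)).mul_right
    (|θ| ^ 3))
  have H4 := ((((s41.hasSum.add (s42.hasSum.mul_left 7)).add (s43.hasSum.mul_left 12)).add
    (s44.hasSum.mul_left 6)).mul_right (|θ| ^ 4))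
  have b3 : ∀ ℓ, ‖logRatioRem (x * a ℓ) (a ℓ * θ)‖ ≤
      ((a ℓ : ℝ) ^ 3 * bose (x * a ℓ) ^ 1 + 3 * ((a ℓ : ℝ) ^ 3 * bose (x * a ℓ) ^ 2) +
        2 * ((a ℓ : ℝ) ^ 3 * bose (x * a ℓ) ^ 3)) * |θ| ^ 3 := fun ℓ => by
    refine (norm_logRatioRem_le (hu ℓ) _).trans_eq ?_
    rw [abs_mul, abs_of_pos (ha.cast_pos ℓ)]; ring
  have b4 : ∀ ℓ, |(logRatioRem (x * a ℓ) (a ℓ * θ)).re| ≤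
      ((a ℓ : ℝ) ^ 4 * bose (x * a ℓ) ^ 1 + 7 * ((a ℓ : ℝ) ^ 4 * bose (x * a ℓ) ^ 2) +
        12 * ((a ℓ : ℝ) ^ 4 * bose (x * a ℓ) ^ 3) +
        6 * ((a ℓ : ℝ) ^ 4 * bose (x * a ℓ) ^ 4)) * |θ| ^ 4 := fun ℓ => by
    refine (abs_re_logRatioRem_le (hu ℓ) _).trans_eq ?_
    rw [abs_mul, abs_of_pos (ha.cast_pos ℓ)]; ring
  have hsum : Summable fun ℓ => logRatioRem (x * a ℓ) (a ℓ * θ) := .of_norm_bounded H3.summable b3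
  refine ⟨?_, ?_, ?_⟩
  · have m1 := (Complex.hasSum_ofReal.mpr (ha.summable_boseMean hκ hx).hasSum).mul_left
      (Complex.I * θ)
    have m2 := (Complex.hasSum_ofReal.mpr (ha.summable_boseVar hκ hx).hasSum).mul_left
      ((θ : ℂ) ^ 2 / 2)
    have := ((m1.sub m2).add hsum.hasSum).tsum_eq
    rw [logChar, boseMean, boseVar]
    refine Eq.trans (tsum_congr fun ℓ => ?_) (this.trans (by ring))
    rw [logRatioRem]; push_cast; ring
  · refine (tsum_of_norm_bounded H3 b3).trans ?_
    have : 0 ≤ x ^ (-κ⁻¹ - 3) := by positivity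
    gcongr
    nlinarith [mul_nonneg hC.le this]
  · rw [Complex.re_tsum hsum, ← Real.norm_eq_abs]
    refine (tsum_of_norm_bounded H4 b4).trans ?_
    have : 0 ≤ x ^ (-κ⁻¹ - 4) := by positivity
    gcongr
    linarith

lemma abs_exp_mul_cos_sub_one_le (r s : ℝ) :
    |Real.exp r * Real.cos s - 1| ≤ (|r| + s ^ 2 / 2) * Real.exp |r| := by
  have h1 : Real.exp r ≤ Real.exp |r| := Real.exp_le_exp.mpr (le_abs_self r)
  have h2 : |1 - Real.cos s| ≤ s ^ 2 / 2 := by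
    rw [abs_of_nonneg (by linarith [Real.cos_le_one s])]
    linarith [Real.one_sub_sq_div_two_le_cos (x := s)]
  have h3 : |Real.exp r - 1| ≤ |r| * Real.exp |r| := by
    have e1 := Real.add_one_le_exp r
    have e2 := Real.add_one_le_exp (-r)
    have e3 : Real.exp r * Real.exp (-r) = 1 := by rw [← Real.exp_add]; simp
    have e4 := Real.exp_pos r
    have e5 : 1 ≤ Real.exp |r| := Real.one_le_exp (abs_nonneg r)
    rcases abs_cases r with ⟨hr, h0⟩ | ⟨hr, h0⟩
    · rw [hr, abs_of_nonneg (by linarith)]; nlinarith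
    · rw [hr, abs_of_nonpos (by linarith [Real.exp_lt_one_iff.mpr h0])]
      rw [hr] at e5
      nlinarith
  calc |Real.exp r * Real.cos s - 1| = |(Real.exp r - 1) - Real.exp r * (1 - Real.cos s)| := by
        congr 1; ring
    _ ≤ |Real.exp r - 1| + |Real.exp r * (1 - Real.cos s)| := abs_sub _ _
    _ ≤ |r| * Real.exp |r| + Real.exp |r| * (s ^ 2 / 2) := by
        rw [abs_mul, abs_of_pos (Real.exp_pos r)]
        gcongr
    _ = _ := by ring

lemma pow_mul_exp_neg_le {y : ℝ} (hy : 0 ≤ y) (k : ℕ) :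
    y ^ k * Real.exp (-(y / 32)) ≤ k.factorial * 64 ^ k * Real.exp (-(y / 64)) := by
  have h := Real.pow_div_factorial_le_exp (y / 64) (by positivity) k
  have hk : (0 : ℝ) < k.factorial := by exact_mod_cast k.factorial_pos
  rw [div_le_iff₀ hk, div_pow, div_le_iff₀ (by positivity)] at h
  have h2 : Real.exp (-(y / 64)) = Real.exp (y / 64) * Real.exp (-(y / 32)) := by
    rw [← Real.exp_add]; congr 1; ring
  rw [h2]
  calc _ ≤ _ := mul_le_mul_of_nonneg_right h (Real.exp_pos _).le
    _ = _ := by ring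

lemma HasPowerGrowth.exists_major_arc {κ : ℝ} {a : ℕ → ℕ} (ha : HasPowerGrowth κ a)
    (hκ : 0 < κ) : ∃ c > 0, c ≤ 1 ∧ ∃ C > 0, ∀ x > 0, x ≤ 1 →
      (∀ θ : ℝ, |θ| ≤ c * x → |(Complex.exp (logChar a x θ) *
        Complex.exp (-(boseMean a x * θ * Complex.I))).re - Real.exp (-(boseVar a x * θ ^ 2 / 2))| ≤
        C * x ^ κ⁻¹ * Real.exp (-(x ^ (-κ⁻¹ - 2) * θ ^ 2 / 64))) ∧
      ∀ θ : ℝ, c * x ≤ |θ| → Real.exp (-(boseVar a x * θ ^ 2 / 2)) ≤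
        C * x ^ κ⁻¹ * Real.exp (-(x ^ (-κ⁻¹ - 2) * θ ^ 2 / 64)) := by
  obtain ⟨B, hB1, h⟩ := ha.exists_logChar_eq hκ
  have hB : 0 < B := by linarith
  have hc : 0 < √(1 / (32 * B)) := Real.sqrt_pos.mpr (by positivity)
  have hc2 : √(1 / (32 * B)) ^ 2 * (32 * B) = 1 := by
    rw [Real.sq_sqrt (by positivity)]; field_simp
  set c := √(1 / (32 * B))
  have hc1 : c ≤ 1 := by nlinarith [mul_nonneg hc.le hc.le]
  refine ⟨c, hc, hc1, 64 * (c ^ 2)⁻¹ + (2 * 64 ^ 2 * B + 6 * 64 ^ 3 * B ^ 2), by positivity,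
    fun x hx hx1 => ?_⟩
  have hV := ha.le_boseVar hκ hx hx1
  set V := boseVar a x
  set W := x ^ (-κ⁻¹ - 2)
  set X := x ^ κ⁻¹
  have hW : 0 < W := by positivity
  have hX : 0 < X := by positivity
  have e2 : X * W * x ^ 2 = 1 := by
    rw [← Real.rpow_natCast, ← Real.rpow_add hx, ← Real.rpow_add hx,
      show κ⁻¹ + (-κ⁻¹ - 2) + (2 : ℕ) = 0 by push_cast; ring, Real.rpow_zero]
  have e4 : x ^ (-κ⁻¹ - 4) = X * W ^ 2 := by
    simp only [X, W]
    rw [← Real.rpow_natCast, ← Real.rpow_mul hx.le, ← Real.rpow_add hx]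
    congr 1; push_cast; ring
  have e3 : (x ^ (-κ⁻¹ - 3)) ^ 2 = X * W ^ 3 := by
    simp only [X, W]
    rw [← Real.rpow_natCast, ← Real.rpow_natCast, ← Real.rpow_mul hx.le, ← Real.rpow_mul hx.le,
      ← Real.rpow_add hx]
    congr 1; push_cast; ring
  refine ⟨fun θ hθ => ?_, fun θ hθ => ?_⟩
  · obtain ⟨E, hE, hE3, hE4⟩ := h x hx θ
    set y := W * θ ^ 2
    have hy : 0 ≤ y := by positivity
    have hr : |E.re| ≤ B * X * y ^ 2 := by
      refine hE4.trans_eq ?_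
      rw [e4, show |θ| ^ 4 = (|θ| ^ 2) ^ 2 by ring, sq_abs]; simp only [y]; ring
    have hs : E.im ^ 2 ≤ B ^ 2 * X * y ^ 3 := by
      have : E.im ^ 2 ≤ (B * x ^ (-κ⁻¹ - 3) * |θ| ^ 3) ^ 2 :=
        sq_le_sq' (by linarith [neg_abs_le E.im, Complex.abs_im_le_norm E])
          ((le_abs_self _).trans ((Complex.abs_im_le_norm E).trans hE3))
      refine this.trans_eq ?_
      rw [mul_pow, mul_pow, e3, show (|θ| ^ 3) ^ 2 = (|θ| ^ 2) ^ 3 by ring, sq_abs]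
      simp only [y]; ring
    have hsmall : B * X * y ^ 2 ≤ y / 32 := by
      have : θ ^ 2 ≤ c ^ 2 * x ^ 2 := by
        rw [← sq_abs, ← mul_pow]; gcongr
      have h1 : B * X * y ≤ 1 / 32 := by
        calc B * X * y = B * X * W * θ ^ 2 := by simp only [y]; ring
          _ ≤ B * X * W * (c ^ 2 * x ^ 2) := by gcongr
          _ = (X * W * x ^ 2) * (c ^ 2 * (32 * B)) / 32 := by ring
          _ = 1 / 32 := by rw [e2, hc2]; norm_num
      nlinarith
    have hVy : y / 16 ≤ V * θ ^ 2 / 2 := by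
      have := mul_le_mul_of_nonneg_right hV (sq_nonneg θ)
      simp only [y]; linarith
    have key : (Complex.exp (logChar a x θ) *
        Complex.exp (-(boseMean a x * θ * Complex.I))).re - Real.exp (-(V * θ ^ 2 / 2)) =
        Real.exp (-(V * θ ^ 2 / 2)) * (Real.exp E.re * Real.cos E.im - 1) := by
      rw [← Complex.exp_add, hE, show Complex.I * boseMean a x * θ - V * (θ : ℂ) ^ 2 / 2 + E +
        -(boseMean a x * θ * Complex.I) = ((-(V * θ ^ 2 / 2) : ℝ) : ℂ) + E by push_cast; ring,
        Complex.exp_add, ← Complex.ofReal_exp, Complex.re_ofReal_mul, Complex.exp_re]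
      ring
    rw [key, abs_mul, abs_of_pos (Real.exp_pos _)]
    calc _ ≤ Real.exp (-(V * θ ^ 2 / 2)) * ((|E.re| + E.im ^ 2 / 2) * Real.exp |E.re|) := by
          gcongr; exact abs_exp_mul_cos_sub_one_le _ _
      _ = (|E.re| + E.im ^ 2 / 2) * Real.exp (-(V * θ ^ 2 / 2) + |E.re|) := by
          rw [Real.exp_add]; ring
      _ ≤ (B * X * y ^ 2 + B ^ 2 * X * y ^ 3) * Real.exp (-(y / 32)) := by
          have : 0 ≤ E.im ^ 2 := sq_nonneg _
          gcongr <;> linarith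
      _ = B * X * (y ^ 2 * Real.exp (-(y / 32))) +
          B ^ 2 * X * (y ^ 3 * Real.exp (-(y / 32))) := by ring
      _ ≤ B * X * ((2 : ℕ).factorial * 64 ^ 2 * Real.exp (-(y / 64))) +
          B ^ 2 * X * ((3 : ℕ).factorial * 64 ^ 3 * Real.exp (-(y / 64))) := by
          exact add_le_add
            (mul_le_mul_of_nonneg_left (pow_mul_exp_neg_le hy 2) (by positivity))
            (mul_le_mul_of_nonneg_left (pow_mul_exp_neg_le hy 3) (by positivity))
      _ = (2 * 64 ^ 2 * B + 6 * 64 ^ 3 * B ^ 2) * X * Real.exp (-(y / 64)) := by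
          norm_num [Nat.factorial]; ring
      _ ≤ _ := by
          have : 0 < 64 * (c ^ 2)⁻¹ := by positivity
          exact mul_le_mul_of_nonneg_right (mul_le_mul_of_nonneg_right (by linarith) hX.le)
            (Real.exp_pos _).le
  · set y := W * θ ^ 2
    have hy : 0 ≤ y := by positivity
    have hVy : y / 32 ≤ V * θ ^ 2 / 2 := by
      have := mul_le_mul_of_nonneg_right hV (sq_nonneg θ)
      simp only [y] at hy ⊢; linarith
    have h1 : 1 ≤ (c ^ 2)⁻¹ * X * y := by
      have : c ^ 2 * x ^ 2 ≤ θ ^ 2 := by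
        rw [← sq_abs θ, ← mul_pow]; gcongr
      calc (1 : ℝ) = (c ^ 2)⁻¹ * X * W * (c ^ 2 * x ^ 2) := by
            rw [show (c ^ 2)⁻¹ * X * W * (c ^ 2 * x ^ 2) =
              ((c ^ 2)⁻¹ * c ^ 2) * (X * W * x ^ 2) by ring, e2, inv_mul_cancel₀ (by positivity)]
            norm_num
        _ ≤ (c ^ 2)⁻¹ * X * W * θ ^ 2 := by gcongr
        _ = _ := by simp only [y]; ring
    calc Real.exp (-(V * θ ^ 2 / 2)) ≤ Real.exp (-(y / 32)) := Real.exp_le_exp.mpr (by linarith)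
      _ ≤ (c ^ 2)⁻¹ * X * y * Real.exp (-(y / 32)) := le_mul_of_one_le_left (Real.exp_pos _).le h1
      _ = (c ^ 2)⁻¹ * X * (y ^ 1 * Real.exp (-(y / 32))) := by ring
      _ ≤ (c ^ 2)⁻¹ * X * ((1 : ℕ).factorial * 64 ^ 1 * Real.exp (-(y / 64))) := by
          exact mul_le_mul_of_nonneg_left (pow_mul_exp_neg_le hy 1) (by positivity)
      _ = 64 * (c ^ 2)⁻¹ * X * Real.exp (-(y / 64)) := by norm_num [Nat.factorial]; ring
      _ ≤ _ := by
          have : 0 < 2 * 64 ^ 2 * B + 6 * 64 ^ 3 * B ^ 2 := by positivity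
          exact mul_le_mul_of_nonneg_right (mul_le_mul_of_nonneg_right (by linarith) hX.le)
            (Real.exp_pos _).le

/-! ### The minor arcs -/

lemma norm_exp_logRatio_sq_mul_le {u : ℝ} (hu : 0 < u) (φ : ℝ) :
    ‖Complex.exp (logRatio u φ)‖ ^ 2 * (u ^ 2 + 4 * Real.exp (-u) * Real.sin (φ / 2) ^ 2) ≤
      u ^ 2 := by
  have h1 : Real.exp (-u) < 1 := Real.exp_lt_one_iff.mpr (by linarith)
  have h2 : 1 - Real.exp (-u) ≤ u := by linarith [Real.one_sub_le_exp_neg u]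
  have h3 : ‖1 - (Real.exp (-u) : ℂ) * Complex.exp (φ * Complex.I)‖ ^ 2 =
      (1 - Real.exp (-u)) ^ 2 + 4 * Real.exp (-u) * Real.sin (φ / 2) ^ 2 := by
    rw [← Complex.normSq_eq_norm_sq, Complex.normSq_apply, Complex.sub_re, Complex.sub_im,
      Complex.re_ofReal_mul, Complex.im_ofReal_mul, Complex.exp_ofReal_mul_I_re,
      Complex.exp_ofReal_mul_I_im, Complex.one_re, Complex.one_im, Real.sin_sq_eq_half_sub,
      mul_div_cancel₀ φ two_ne_zero]
    linear_combination Real.exp (-u) ^ 2 * Real.sin_sq_add_cos_sq φ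
  have hpos : 0 < (1 - Real.exp (-u)) ^ 2 := pow_pos (by linarith) 2
  have h4 : 0 ≤ 4 * Real.exp (-u) * Real.sin (φ / 2) ^ 2 := by positivity
  have h5 : (1 - Real.exp (-u)) ^ 2 ≤ u ^ 2 := pow_le_pow_left₀ (by linarith) h2 2
  rw [norm_exp_logRatio hu, div_pow, h3, div_mul_eq_mul_div, div_le_iff₀ (by linarith)]
  nlinarith

lemma norm_exp_logRatio_mul_abs_sin_le {u : ℝ} (hu : 0 < u) (φ : ℝ) :
    ‖Complex.exp (logRatio u φ)‖ * |Real.sin (φ / 2)| ≤ u * Real.exp u := by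
  have h := norm_exp_logRatio_sq_mul_le hu φ
  have h1 : Real.exp u * Real.exp (-u) = 1 := by rw [← Real.exp_add]; simp
  have h2 : 1 ≤ Real.exp u := Real.one_le_exp hu.le
  refine abs_le_of_sq_le_sq' ?_ (by positivity) |>.2
  rw [mul_pow, sq_abs]
  set r := ‖Complex.exp (logRatio u φ)‖ ^ 2
  set s := Real.sin (φ / 2) ^ 2
  have hr : 0 ≤ r := by positivity
  have hs : 0 ≤ s := by positivity
  have h3 : r * s * Real.exp (-u) ≤ u ^ 2 := by
    nlinarith [mul_nonneg hr (sq_nonneg u), mul_nonneg (mul_nonneg hr hs) (Real.exp_pos (-u)).le]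
  calc r * s = r * s * Real.exp (-u) * Real.exp u := by
        rw [mul_assoc (r * s), mul_comm (Real.exp (-u)), h1, mul_one]
    _ ≤ u ^ 2 * Real.exp u := by gcongr
    _ ≤ u ^ 2 * Real.exp u ^ 2 := by gcongr; exact le_self_pow₀ h2 two_ne_zero
    _ = _ := by ring

lemma HasPowerGrowth.norm_exp_logChar_sq_mul_le {κ : ℝ} {a : ℕ → ℕ} (ha : HasPowerGrowth κ a)
    (hκ : 0 < κ) {c : ℝ} (hc : 0 < c) {x θ : ℝ} (hx : 0 < x) (hθ : c * x ≤ |θ|) :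
    ‖Complex.exp (logChar a x θ)‖ ^ 2 *
      (1 + Real.exp (-c⁻¹) / 4 * (|θ| / x) ^ 2) ^ ⌊|θ| ^ (-κ⁻¹)⌋₊ ≤ 1 := by
  have hθ0 : 0 < |θ| := (mul_pos hc hx).trans_le hθ
  set S := Finset.range ⌊|θ| ^ (-κ⁻¹)⌋₊
  have hfac : ∀ ℓ ∈ S, ‖Complex.exp (logRatio (x * a ℓ) (a ℓ * θ))‖ ^ 2 *
      (1 + Real.exp (-c⁻¹) / 4 * (|θ| / x) ^ 2) ≤ 1 := fun ℓ hℓ => by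
    have hapos := ha.cast_pos ℓ
    have hu := mul_pos hx hapos
    have h1 := ha.mul_le_one hκ hθ0 hℓ
    have h2 : x * a ℓ ≤ c⁻¹ := by
      rw [le_inv_comm₀ hu hc, ← one_div, le_div_iff₀ hu]
      nlinarith
    have h3 := norm_exp_logRatio_sq_mul_le hu (a ℓ * θ)
    have h4 : (a ℓ * |θ| / 4) ^ 2 ≤ Real.sin (a ℓ * θ / 2) ^ 2 := by
      have e1 : |a ℓ * θ / 2| = a ℓ * |θ| / 2 := by
        rw [abs_div, abs_mul, abs_of_pos hapos, abs_of_pos (two_pos : (0 : ℝ) < 2)]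
      have e2 := Real.mul_abs_le_abs_sin (x := a ℓ * θ / 2) (by
        rw [e1]; linarith [Real.pi_gt_three])
      rw [e1] at e2
      have e3 : 1 / 2 ≤ 2 / π := by
        rw [div_le_div_iff₀ two_pos pi_pos]; linarith [Real.pi_le_four]
      rw [← sq_abs (Real.sin _)]
      refine pow_le_pow_left₀ (by positivity) (le_trans ?_ e2) 2
      have : 0 ≤ a ℓ * |θ| / 2 := by positivity
      nlinarith
    have h5 : Real.exp (-c⁻¹) ≤ Real.exp (-(x * a ℓ)) := Real.exp_le_exp.mpr (by linarith)
    have h6 : (x * a ℓ) ^ 2 * (1 + Real.exp (-c⁻¹) / 4 * (|θ| / x) ^ 2) ≤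
        (x * a ℓ) ^ 2 + 4 * Real.exp (-(x * a ℓ)) * Real.sin (a ℓ * θ / 2) ^ 2 := by
      calc _ = (x * a ℓ) ^ 2 + 4 * Real.exp (-c⁻¹) * (a ℓ * |θ| / 4) ^ 2 := by field_simp
        _ ≤ _ := by gcongr
    have h7 := (mul_le_mul_of_nonneg_left h6
      (sq_nonneg ‖Complex.exp (logRatio (x * a ℓ) (a ℓ * θ))‖)).trans h3
    refine le_of_mul_le_mul_left (h7.trans_eq' ?_ |>.trans_eq (mul_one _).symm) (pow_pos hu 2)
    ring
  have hS := pow_le_pow_left₀ (norm_nonneg _) (ha.norm_exp_logChar_le_prod hκ hx θ S) 2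
  calc _ ≤ (∏ ℓ ∈ S, ‖Complex.exp (logRatio (x * a ℓ) (a ℓ * θ))‖) ^ 2 *
        (1 + Real.exp (-c⁻¹) / 4 * (|θ| / x) ^ 2) ^ S.card := by
          rw [Finset.card_range]; gcongr
    _ = ∏ ℓ ∈ S, ‖Complex.exp (logRatio (x * a ℓ) (a ℓ * θ))‖ ^ 2 *
        (1 + Real.exp (-c⁻¹) / 4 * (|θ| / x) ^ 2) := by
          rw [Finset.prod_mul_distrib, Finset.prod_const, Finset.prod_pow]
    _ ≤ 1 := Finset.prod_le_one (fun _ _ => by positivity) hfac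

lemma exists_le_one_add_pow {δ α : ℝ} (hδ : 0 < δ) (hα : 0 < α) (K : ℕ) :
    ∃ D > (0 : ℝ), ∀ x > (0 : ℝ), x ≤ 1 → ∀ m : ℕ, x ^ (-α) / 2 ≤ m →
      D * (x⁻¹) ^ K ≤ (1 + δ) ^ m := by
  obtain ⟨N, hN⟩ := exists_nat_gt (K / α)
  rw [div_lt_iff₀ hα] at hN
  have hη : 0 < Real.log (1 + δ) := Real.log_pos (by linarith)
  have hfac : (0 : ℝ) < N.factorial := by exact_mod_cast N.factorial_pos
  refine ⟨(Real.log (1 + δ) / 2) ^ N / N.factorial, by positivity, fun x hx hx1 m hm => ?_⟩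
  have h1 : (x⁻¹) ^ K ≤ (x ^ (-α)) ^ N := by
    rw [← Real.rpow_natCast (x ^ (-α)), ← Real.rpow_mul hx.le, ← Real.rpow_natCast x⁻¹,
      ← Real.rpow_neg_one, ← Real.rpow_mul hx.le]
    exact Real.rpow_le_rpow_of_exponent_ge hx hx1 (by linarith)
  calc _ ≤ (Real.log (1 + δ) / 2) ^ N / N.factorial * (2 * m : ℝ) ^ N := by
        gcongr
        exact h1.trans (pow_le_pow_left₀ (by positivity) (by linarith) N)
    _ = (Real.log (1 + δ) * m) ^ N / N.factorial := by
        rw [div_mul_eq_mul_div, ← mul_pow]; congr 2; ring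
    _ ≤ Real.exp (Real.log (1 + δ) * m) := Real.pow_div_factorial_le_exp _ (by positivity) N
    _ = (1 + δ) ^ m := by
        rw [mul_comm, Real.exp_nat_mul, Real.exp_log (by linarith)]

lemma HasPowerGrowth.exists_near_minor_arc {κ : ℝ} {a : ℕ → ℕ} (ha : HasPowerGrowth κ a)
    (hκ : 0 < κ) {c : ℝ} (hc : 0 < c) (K : ℕ) :
    ∃ c₁ > 0, ∃ C > 0, ∀ x > 0, x ≤ 1 → ∀ θ : ℝ, c * x ≤ |θ| → |θ| ≤ c₁ →
      ‖Complex.exp (logChar a x θ)‖ ≤ C * x ^ K := by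
  have hδ : 0 < Real.exp (-c⁻¹) / 4 := by positivity
  obtain ⟨δ, hδdef⟩ : ∃ δ, δ = Real.exp (-c⁻¹) / 4 := ⟨_, rfl⟩
  rw [← hδdef] at hδ
  obtain ⟨D, hD, hDle⟩ := exists_le_one_add_pow (δ := δ * c ^ 2) (α := κ⁻¹ / 2) (by positivity)
    (by positivity) (2 * K)
  have hD' : 0 < min D (δ ^ (2 * K)) := lt_min hD (by positivity)
  refine ⟨(2 * K + 1) ^ (-κ), by positivity, √(min D (δ ^ (2 * K)))⁻¹, by positivity,
    fun x hx hx1 θ hθ hθ1 => ?_⟩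
  have hθ0 : 0 < |θ| := (mul_pos hc hx).trans_le hθ
  have hθα : (2 * K + 1 : ℝ) ≤ |θ| ^ (-κ⁻¹) := by
    have := Real.rpow_le_rpow_of_nonpos hθ0 hθ1 (neg_nonpos.mpr (inv_pos.mpr hκ).le)
    rwa [← Real.rpow_mul (by positivity), neg_mul_neg, mul_inv_cancel₀ hκ.ne',
      Real.rpow_one] at this
  have hmain := ha.norm_exp_logChar_sq_mul_le hκ hc hx hθ
  rw [← hδdef] at hmain
  set m := ⌊|θ| ^ (-κ⁻¹)⌋₊
  have hbase : min D (δ ^ (2 * K)) * (x⁻¹) ^ (2 * K) ≤ (1 + δ * (|θ| / x) ^ 2) ^ m := by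
    rcases le_total |θ| √x with h | h
    · have h1 : x ^ (-(κ⁻¹ / 2)) / 2 ≤ m := by
        have e1 : x ^ (-(κ⁻¹ / 2)) ≤ |θ| ^ (-κ⁻¹) := by
          have := Real.rpow_le_rpow_of_nonpos hθ0 h (neg_nonpos.mpr (inv_pos.mpr hκ).le)
          rw [Real.sqrt_eq_rpow, ← Real.rpow_mul hx.le] at this
          convert this using 2
          ring
        have e2 := half_le_floor (y := |θ| ^ (-κ⁻¹)) (by
          linarith [K.cast_nonneg (α := ℝ)])
        linarith
      have h2 : c ≤ |θ| / x := by rwa [le_div_iff₀ hx]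
      calc _ ≤ D * (x⁻¹) ^ (2 * K) := by gcongr; exact min_le_left _ _
        _ ≤ (1 + δ * c ^ 2) ^ m := hDle x hx hx1 m h1
        _ ≤ _ := by gcongr
    · have h1 : 2 * K ≤ m := Nat.le_floor (by push_cast; linarith)
      have h2 : x⁻¹ ≤ (|θ| / x) ^ 2 := by
        have : x ≤ |θ| ^ 2 := by
          rw [← Real.sq_sqrt hx.le]; gcongr
        rw [div_pow, le_div_iff₀ (by positivity)]
        calc x⁻¹ * x ^ 2 = x := by field_simp
          _ ≤ _ := this
      calc _ ≤ δ ^ (2 * K) * (x⁻¹) ^ (2 * K) := by gcongr; exact min_le_right _ _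
        _ = (δ * x⁻¹) ^ (2 * K) := by rw [mul_pow]
        _ ≤ (1 + δ * (|θ| / x) ^ 2) ^ (2 * K) := by
            refine pow_le_pow_left₀ (by positivity) ?_ _
            have := mul_le_mul_of_nonneg_left h2 hδ.le
            linarith
        _ ≤ _ := pow_le_pow_right₀ (le_add_of_nonneg_right (by positivity)) h1
  refine abs_le_of_sq_le_sq' ?_ (by positivity) |>.2
  rw [mul_pow, Real.sq_sqrt (by positivity), ← pow_mul, mul_comm K]
  have h1 := (mul_le_mul_of_nonneg_left hbase (sq_nonneg _)).trans hmain
  rw [inv_pow] at h1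
  calc ‖Complex.exp (logChar a x θ)‖ ^ 2 = (‖Complex.exp (logChar a x θ)‖ ^ 2 *
        (min D (δ ^ (2 * K)) * (x ^ (2 * K))⁻¹)) *
        ((min D (δ ^ (2 * K)))⁻¹ * x ^ (2 * K)) := by field_simp
    _ ≤ 1 * ((min D (δ ^ (2 * K)))⁻¹ * x ^ (2 * K)) := by gcongr
    _ = _ := one_mul _

lemma exists_sin_mul_ne_zero {a : ℕ → ℕ} (ha : ∀ ℓ, 1 ≤ a ℓ)
    (hnd : ∀ q ≥ 2, ∀ ℓ₀, ∃ ℓ ≥ ℓ₀, ¬ q ∣ a ℓ) {θ : ℝ} (hθ0 : θ ≠ 0) (hθ : |θ| ≤ π) (ℓ₀ : ℕ) :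
    ∃ ℓ ≥ ℓ₀, Real.sin (a ℓ * θ / 2) ≠ 0 := by
  by_contra! hzero
  have hint : ∀ ℓ ≥ ℓ₀, ∃ k : ℤ, (k : ℝ) = a ℓ * (θ / (2 * π)) := fun ℓ hℓ => by
    obtain ⟨k, hk⟩ := Real.sin_eq_zero_iff.mp (hzero ℓ hℓ)
    refine ⟨k, ?_⟩
    field_simp
    linarith
  obtain ⟨k₀, hk₀⟩ := hint ℓ₀ le_rfl
  have ha0 : (a ℓ₀ : ℝ) ≠ 0 := by exact_mod_cast Nat.one_le_iff_ne_zero.mp (ha ℓ₀)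
  set r : ℚ := k₀ / a ℓ₀
  have hr : (r : ℝ) = θ / (2 * π) := by
    simp only [r]; push_cast; rw [hk₀]; field_simp
  have hr0 : r ≠ 0 := by
    intro h
    rw [h, Rat.cast_zero, eq_comm, div_eq_zero_iff] at hr
    exact hr.elim hθ0 (by positivity)
  have hr1 : |r| < 1 := by
    have : |(r : ℝ)| < 1 := by
      rw [hr, abs_div, abs_of_pos (by positivity : 0 < 2 * π), div_lt_one (by positivity)]
      linarith [pi_pos]
    exact_mod_cast this
  have hden : 2 ≤ r.den := by
    by_contra! h
    have h1 : r.den = 1 := by have := r.den_pos; omega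
    have h2 : ((r.num : ℤ) : ℚ) = r := (Rat.den_eq_one_iff r).mp h1
    rw [← h2] at hr1 hr0
    have h3 : |r.num| < 1 := by exact_mod_cast hr1
    exact hr0 (by exact_mod_cast Int.abs_lt_one_iff.mp h3)
  obtain ⟨ℓ, hℓ, hdvd⟩ := hnd r.den hden ℓ₀
  obtain ⟨k, hk⟩ := hint ℓ hℓ
  rw [← hr] at hk
  have hkq : (k : ℚ) = a ℓ * r := by exact_mod_cast hk
  have hmul : (a ℓ : ℤ) * r.num = k * r.den := by
    have : (a ℓ : ℚ) * r.num = k * r.den := by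
      rw [hkq, mul_assoc, Rat.mul_den_eq_num]
    exact_mod_cast this
  have hcop : IsCoprime r.num (r.den : ℤ) := by
    simpa [Int.isCoprime_iff_nat_coprime] using r.reduced
  have hdz : (r.den : ℤ) ∣ a ℓ := hcop.symm.dvd_of_dvd_mul_right (hmul ▸ Dvd.intro_left k rfl)
  exact hdvd (by exact_mod_cast hdz)

lemma HasPowerGrowth.exists_far_minor_arc {κ : ℝ} {a : ℕ → ℕ} (ha : HasPowerGrowth κ a)
    (hκ : 0 < κ) (hnd : ∀ q ≥ 2, ∀ ℓ₀, ∃ ℓ ≥ ℓ₀, ¬ q ∣ a ℓ) {c : ℝ} (hc : 0 < c) (K : ℕ) :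
    ∃ C > 0, ∀ x > 0, x ≤ 1 → ∀ θ : ℝ, c ≤ |θ| → |θ| ≤ π →
      ‖Complex.exp (logChar a x θ)‖ ≤ C * x ^ K := by
  have hcomp : IsCompact (Set.Icc (-π) π ∩ {θ | c ≤ |θ|}) :=
    isCompact_Icc.inter_right (isClosed_le continuous_const continuous_abs)
  have key := hcomp.induction_on (p := fun s => ∃ C > 0, ∀ θ ∈ s, ∀ x > 0, x ≤ 1 →
      ‖Complex.exp (logChar a x θ)‖ ≤ C * x ^ K) ⟨1, one_pos, by simp⟩
    (fun s t hst ⟨C, hC, h⟩ => ⟨C, hC, fun θ hθ => h θ (hst hθ)⟩) ?_ ?_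
  · obtain ⟨C, hC, h⟩ := key
    exact ⟨C, hC, fun x hx hx1 θ h1 h2 => h θ ⟨abs_le.mp h2, h1⟩ x hx hx1⟩
  · rintro s t ⟨C, hC, h⟩ ⟨C', hC', h'⟩
    refine ⟨C + C', by positivity, fun θ hθ x hx hx1 => ?_⟩
    have hxK : 0 ≤ x ^ K := by positivity
    rcases hθ with hθ | hθ
    · refine (h θ hθ x hx hx1).trans ?_
      gcongr; linarith
    · refine (h' θ hθ x hx hx1).trans ?_
      gcongr; linarith
  · rintro θ₀ ⟨hθπ, hcθ⟩
    have hθ0 : θ₀ ≠ 0 := abs_pos.mp (hc.trans_le hcθ)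
    have hinf : {ℓ | Real.sin (a ℓ * θ₀ / 2) ≠ 0}.Infinite :=
      Set.infinite_of_forall_exists_gt fun ℓ₀ => by
        obtain ⟨ℓ, hℓ, h⟩ := exists_sin_mul_ne_zero ha.one_le hnd hθ0 (abs_le.mpr hθπ) (ℓ₀ + 1)
        exact ⟨ℓ, h, hℓ⟩
    obtain ⟨S, hS, hcard⟩ := hinf.exists_subset_card_eq K
    set g : ℝ → ℝ := fun θ => ∏ ℓ ∈ S, |Real.sin (a ℓ * θ / 2)|
    have hg : Continuous g := continuous_finsetProd _ fun ℓ _ => by fun_prop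
    have hg0 : 0 < g θ₀ := Finset.prod_pos fun ℓ hℓ => abs_pos.mpr (hS hℓ)
    refine ⟨{θ | g θ₀ / 2 < g θ}, mem_nhdsWithin_of_mem_nhds
      ((isOpen_lt continuous_const hg).mem_nhds (half_lt_self hg0)),
      (∏ ℓ ∈ S, (a ℓ : ℝ) * Real.exp (a ℓ)) / (g θ₀ / 2), ?_, fun θ hθ x hx hx1 => ?_⟩
    · exact div_pos (Finset.prod_pos fun ℓ _ => mul_pos (ha.cast_pos ℓ) (Real.exp_pos _))
        (half_pos hg0)
    have hθ' : g θ₀ / 2 < g θ := hθ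
    rw [div_mul_eq_mul_div, le_div_iff₀ (half_pos hg0)]
    calc ‖Complex.exp (logChar a x θ)‖ * (g θ₀ / 2)
        ≤ (∏ ℓ ∈ S, ‖Complex.exp (logRatio (x * a ℓ) (a ℓ * θ))‖) * g θ := by
          have := ha.norm_exp_logChar_le_prod hκ hx θ S
          gcongr
      _ = ∏ ℓ ∈ S, ‖Complex.exp (logRatio (x * a ℓ) (a ℓ * θ))‖ * |Real.sin (a ℓ * θ / 2)| :=
          Finset.prod_mul_distrib.symm
      _ ≤ ∏ ℓ ∈ S, x * ((a ℓ : ℝ) * Real.exp (a ℓ)) := by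
          refine Finset.prod_le_prod (fun ℓ _ => by positivity) fun ℓ _ => ?_
          refine (norm_exp_logRatio_mul_abs_sin_le (mul_pos hx (ha.cast_pos ℓ)) _).trans ?_
          rw [mul_assoc]
          have := ha.cast_pos ℓ
          gcongr
          exact mul_le_of_le_one_left this.le hx1
      _ = _ := by
          rw [Finset.prod_mul_distrib, Finset.prod_const, hcard, mul_comm]

lemma HasPowerGrowth.exists_minor_arc {κ : ℝ} {a : ℕ → ℕ} (ha : HasPowerGrowth κ a)
    (hκ : 0 < κ) (hnd : ∀ q ≥ 2, ∀ ℓ₀, ∃ ℓ ≥ ℓ₀, ¬ q ∣ a ℓ) {c : ℝ} (hc : 0 < c) (K : ℕ) :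
    ∃ C > 0, ∀ x > 0, x ≤ 1 → ∀ θ : ℝ, c * x ≤ |θ| → |θ| ≤ π →
      ‖Complex.exp (logChar a x θ)‖ ≤ C * x ^ K := by
  obtain ⟨c₁, hc₁, C₁, hC₁, h₁⟩ := ha.exists_near_minor_arc hκ hc K
  obtain ⟨C₂, hC₂, h₂⟩ := ha.exists_far_minor_arc hκ hnd hc₁ K
  refine ⟨C₁ + C₂, by positivity, fun x hx hx1 θ hθ hθπ => ?_⟩
  have hxK : 0 ≤ x ^ K := by positivity
  rcases le_total |θ| c₁ with h | h
  · refine (h₁ x hx hx1 θ hθ h).trans ?_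
    gcongr; linarith
  · refine (h₂ x hx hx1 θ h hθπ).trans ?_
    gcongr; linarith

/-! ### The saddle point asymptotics -/

lemma HasPowerGrowth.exists_boseVar_le {κ : ℝ} {a : ℕ → ℕ} (ha : HasPowerGrowth κ a)
    (hκ : 0 < κ) : ∃ C > 0, ∀ x > 0, boseVar a x ≤ C * x ^ (-κ⁻¹ - 2) := by
  obtain ⟨C, hC, h⟩ := ha.exists_tsum_pow_mul_bose_pow_le hκ
  refine ⟨2 * C, by positivity, fun x hx => ?_⟩
  obtain ⟨s1, t1⟩ := h x hx 1 2 le_rfl (by norm_num) (by norm_num)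
  obtain ⟨s2, t2⟩ := h x hx 2 2 (by norm_num) le_rfl (by norm_num)
  push_cast at t1 t2
  have : boseVar a x = ∑' ℓ, (a ℓ : ℝ) ^ 2 * bose (x * a ℓ) ^ 1 +
      ∑' ℓ, (a ℓ : ℝ) ^ 2 * bose (x * a ℓ) ^ 2 := by
    rw [← s1.tsum_add s2, boseVar]
    exact tsum_congr fun ℓ => by ring
  linarith

lemma HasPowerGrowth.exists_abs_integral_sub_le {κ : ℝ} {a : ℕ → ℕ} (ha : HasPowerGrowth κ a)
    (hκ : 0 < κ) (hnd : ∀ q ≥ 2, ∀ ℓ₀, ∃ ℓ ≥ ℓ₀, ¬ q ∣ a ℓ) (K : ℕ) :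
    ∃ C > 0, ∀ x > 0, x ≤ 1 → |(∫ θ in (-π)..π, (Complex.exp (logChar a x θ) *
      Complex.exp (-(boseMean a x * θ * Complex.I))).re) - √(2 * π / boseVar a x)| ≤
      C * (x ^ κ⁻¹ / √(x ^ (-κ⁻¹ - 2)) + x ^ K) := by
  obtain ⟨c, hc, hc1, C₁, hC₁, hmaj⟩ := ha.exists_major_arc hκ
  obtain ⟨C₂, hC₂, hmin⟩ := ha.exists_minor_arc hκ hnd hc K
  refine ⟨C₁ * √(64 * π) + 2 * π * C₂, by positivity, fun x hx hx1 => ?_⟩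
  obtain ⟨hmaj₁, hmaj₂⟩ := hmaj x hx hx1
  have hW : 0 < x ^ (-κ⁻¹ - 2) := by positivity
  have hV : 0 < boseVar a x := lt_of_lt_of_le (by positivity) (ha.le_boseVar hκ hx hx1)
  set V := boseVar a x
  set W := x ^ (-κ⁻¹ - 2)
  set F : ℝ → ℝ := fun θ => (Complex.exp (logChar a x θ) *
    Complex.exp (-(boseMean a x * θ * Complex.I))).re
  have hFle : ∀ θ, |F θ| ≤ ‖Complex.exp (logChar a x θ)‖ := fun θ => by
    refine (Complex.abs_re_le_norm _).trans_eq ?_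
    rw [norm_mul, show (-(boseMean a x * θ * Complex.I) : ℂ) =
      ((-(boseMean a x * θ) : ℝ) : ℂ) * Complex.I by push_cast; ring,
      Complex.norm_exp_ofReal_mul_I, mul_one]
  have hFint : MeasureTheory.IntegrableOn F (Set.Ioc (-π) π) := by
    have : ContinuousOn F (Set.Icc (-π) π) := Complex.continuous_re.comp_continuousOn
      ((ha.continuousOn_logChar hκ hx).cexp.mul (by fun_prop))
    exact this.integrableOn_Icc.mono_set Set.Ioc_subset_Icc_self
  have hGint : MeasureTheory.Integrable fun θ : ℝ => Real.exp (-(V * θ ^ 2 / 2)) := by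
    refine (integrable_exp_neg_mul_sq (half_pos hV)).congr (.of_forall fun θ => ?_)
    simp only; congr 1; ring
  have hG : ∫ θ : ℝ, Real.exp (-(V * θ ^ 2 / 2)) = √(2 * π / V) := by
    rw [show 2 * π / V = π / (V / 2) by field_simp, ← integral_gaussian]
    congr 1; funext θ; congr 1; ring
  have hHint : MeasureTheory.Integrable fun θ : ℝ => Real.exp (-(W * θ ^ 2 / 64)) := by
    refine (integrable_exp_neg_mul_sq (b := W / 64) (by positivity)).congr (.of_forall fun θ => ?_)
    simp only; congr 1; ring
  have hH : ∫ θ : ℝ, Real.exp (-(W * θ ^ 2 / 64)) = √(64 * π) / √W := by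
    rw [← Real.sqrt_div (by positivity), show 64 * π / W = π / (W / 64) by field_simp,
      ← integral_gaussian]
    congr 1; funext θ; congr 1; ring
  have hcint : MeasureTheory.IntegrableOn (fun _ : ℝ => C₂ * x ^ K) (Set.Ioc (-π) π) :=
    MeasureTheory.integrableOn_const (by simp)
  have hpt : ∀ θ, ‖(Set.Ioc (-π) π).indicator F θ - Real.exp (-(V * θ ^ 2 / 2))‖ ≤
      C₁ * x ^ κ⁻¹ * Real.exp (-(W * θ ^ 2 / 64)) +
        (Set.Ioc (-π) π).indicator (fun _ => C₂ * x ^ K) θ := fun θ => by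
    have hpos : 0 ≤ C₂ * x ^ K := by positivity
    have hG0 := Real.exp_pos (-(V * θ ^ 2 / 2))
    rw [Real.norm_eq_abs]
    by_cases hθ : θ ∈ Set.Ioc (-π) π
    · rw [Set.indicator_of_mem hθ, Set.indicator_of_mem hθ]
      rcases le_total |θ| (c * x) with h | h
      · linarith [hmaj₁ θ h]
      · have h1 := hmin x hx hx1 θ h (abs_le.mpr ⟨hθ.1.le, hθ.2⟩)
        have h2 := hmaj₂ θ h
        have h3 := abs_sub (F θ) (Real.exp (-(V * θ ^ 2 / 2)))
        rw [abs_of_pos hG0] at h3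
        linarith [hFle θ]
    · rw [Set.indicator_of_notMem hθ, Set.indicator_of_notMem hθ, zero_sub, abs_neg,
        abs_of_pos hG0, add_zero]
      refine hmaj₂ θ ?_
      have h1 : c * x ≤ 1 := mul_le_one₀ hc1 hx.le hx1
      have h2 : π ≤ |θ| := by
        by_contra! h
        exact hθ ⟨(abs_lt.mp h).1, (abs_lt.mp h).2.le⟩
      linarith [Real.pi_gt_three]
  have hmeas := measurableSet_Ioc (a := -π) (b := π)
  have hbound := MeasureTheory.norm_integral_le_of_norm_le ((hHint.const_mul (C₁ * x ^ κ⁻¹)).add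
    ((MeasureTheory.integrable_indicator_iff hmeas).mpr hcint)) (.of_forall hpt)
  rw [MeasureTheory.integral_sub ((MeasureTheory.integrable_indicator_iff hmeas).mpr hFint) hGint,
    MeasureTheory.integral_indicator hmeas, hG,
    MeasureTheory.integral_add' (hHint.const_mul _)
      ((MeasureTheory.integrable_indicator_iff hmeas).mpr hcint),
    MeasureTheory.integral_indicator hmeas, MeasureTheory.integral_const_mul, hH,
    MeasureTheory.setIntegral_const, Real.volume_real_Ioc_of_le (by linarith [pi_pos]),
    smul_eq_mul, Real.norm_eq_abs] at hbound
  rw [intervalIntegral.integral_of_le (by linarith [pi_pos])]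
  refine hbound.trans ?_
  have h1 : 0 ≤ x ^ κ⁻¹ / √W := by positivity
  have h2 : 0 ≤ x ^ K := by positivity
  calc _ = C₁ * √(64 * π) * (x ^ κ⁻¹ / √W) + 2 * π * C₂ * x ^ K := by ring
    _ ≤ C₁ * √(64 * π) * (x ^ κ⁻¹ / √W) + 2 * π * C₂ * x ^ K +
        (2 * π * C₂ * (x ^ κ⁻¹ / √W) + C₁ * √(64 * π) * x ^ K) :=
        le_add_of_nonneg_right (by positivity)
    _ = _ := by ring

lemma HasPowerGrowth.exists_abs_card_mul_sub_one_le {κ : ℝ} {a : ℕ → ℕ} (ha : HasPowerGrowth κ a)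
    (hκ : 0 < κ) (hnd : ∀ q ≥ 2, ∀ ℓ₀, ∃ ℓ ≥ ℓ₀, ¬ q ∣ a ℓ) :
    ∃ C > 0, ∀ x > 0, x ≤ 1 → ∀ n : ℕ, boseMean a x = n →
      |(Nat.card {r : ℕ →₀ ℕ // (r.sum fun ℓ j => j * a ℓ) = n} : ℝ) *
        √(2 * π * boseVar a x) *
        Real.exp ((∑' ℓ, Real.log (1 - Real.exp (-x * (a ℓ : ℝ)))) - n * x) - 1| ≤
        C * x ^ κ⁻¹ := by
  obtain ⟨K, hK⟩ := exists_nat_ge (3 / 2 * κ⁻¹ + 1)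
  obtain ⟨C₁, hC₁, h₁⟩ := ha.exists_abs_integral_sub_le hκ hnd K
  obtain ⟨C₂, hC₂, h₂⟩ := ha.exists_boseVar_le hκ
  refine ⟨C₁ * √(2 * π * C₂) / π, by positivity, fun x hx hx1 n hn => ?_⟩
  have hW : 0 < x ^ (-κ⁻¹ - 2) := by positivity
  have hV : 0 < boseVar a x := lt_of_lt_of_le (by positivity) (ha.le_boseVar hκ hx hx1)
  have hVle := h₂ x hx
  have hint := h₁ x hx hx1
  have hKW : x ^ K * √(x ^ (-κ⁻¹ - 2)) ≤ x ^ κ⁻¹ := by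
    rw [Real.sqrt_eq_rpow, ← Real.rpow_natCast, ← Real.rpow_mul hx.le, ← Real.rpow_add hx]
    exact Real.rpow_le_rpow_of_exponent_ge hx hx1 (by linarith)
  set V := boseVar a x
  set W := x ^ (-κ⁻¹ - 2)
  set X := x ^ κ⁻¹
  have hid := congrArg Complex.re (ha.card_mul_exp_eq_integral hκ hx n)
  rw [Complex.ofReal_re, ← Complex.reCLM_apply, ← ContinuousLinearMap.intervalIntegral_comp_comm]
    at hid
  swap
  · refine ContinuousOn.intervalIntegrable ?_
    rw [Set.uIcc_of_le (by linarith [pi_pos])]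
    exact (ha.continuousOn_logChar hκ hx).cexp.mul (by fun_prop)
  simp only [Complex.reCLM_apply] at hid
  rw [hn] at hint
  push_cast at hint
  rw [← hid] at hint
  have hsq : √(2 * π / V) * √(2 * π * V) = 2 * π := by
    rw [← Real.sqrt_mul (by positivity), show 2 * π / V * (2 * π * V) = (2 * π) ^ 2 by
      field_simp, Real.sqrt_sq (by positivity)]
  have hsV : √(2 * π * V) ≤ √(2 * π * C₂) * √W := by
    rw [← Real.sqrt_mul (by positivity)]
    exact Real.sqrt_le_sqrt (by nlinarith [pi_pos])
  simp only [neg_mul]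
  set p : ℝ := (Nat.card {r : ℕ →₀ ℕ // (r.sum fun ℓ j => j * a ℓ) = n} : ℝ)
  set T := ∑' ℓ, Real.log (1 - Real.exp (-(x * (a ℓ : ℝ))))
  have hrw : p * √(2 * π * V) * Real.exp (T - n * x) - 1 =
      (2 * π * p * Real.exp (-(n * x)) * Real.exp T - √(2 * π / V)) * √(2 * π * V) / (2 * π) := by
    rw [sub_mul _ _ (√(2 * π * V)), hsq, sub_div, div_self (by positivity),
      sub_eq_add_neg T, Real.exp_add]
    field_simp
  rw [hrw, abs_div, abs_mul, abs_of_nonneg (Real.sqrt_nonneg (2 * π * V)),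
    abs_of_pos (by positivity : 0 < 2 * π), div_le_iff₀ (by positivity)]
  calc _ ≤ C₁ * (X / √W + x ^ K) * (√(2 * π * C₂) * √W) := by gcongr
    _ = C₁ * √(2 * π * C₂) * (X + x ^ K * √W) := by
        have : √W ≠ 0 := by positivity
        field_simp
    _ ≤ C₁ * √(2 * π * C₂) * (X + X) := by gcongr
    _ = _ := by field_simp; ring

lemma HasPowerGrowth.exists_boseMean_eq {κ : ℝ} {a : ℕ → ℕ} (ha : HasPowerGrowth κ a)
    (hκ : 0 < κ) {y : ℝ} (hy : 0 < y) : ∃ x > 0, boseMean a x = y := by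
  obtain ⟨C, hC, h⟩ := ha.exists_boseMean_le hκ
  have hcont : ContinuousOn (boseMean a) (Set.Ioi 0) := fun x hx =>
    (ha.hasDerivAt_boseMean hκ hx).continuousAt.continuousWithinAt
  have ha0 := ha.cast_pos 0
  have hlarge : ∃ x ∈ Set.Ioi (0 : ℝ), boseMean a x ≤ y := by
    have hlim : Tendsto (fun x : ℝ => C * x ^ (-(κ⁻¹ + 1))) atTop (𝓝 (C * 0)) :=
      (tendsto_rpow_neg_atTop (by positivity)).const_mul C
    rw [mul_zero] at hlim
    obtain ⟨x, hx, hxy⟩ := ((eventually_gt_atTop 0).and (hlim.eventually_lt_const hy)).exists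
    refine ⟨x, hx, (h x hx).trans ?_⟩
    rw [show -κ⁻¹ - 1 = -(κ⁻¹ + 1) by ring]
    exact hxy.le
  have hsmall : ∃ x ∈ Set.Ioi (0 : ℝ), y ≤ boseMean a x := by
    have hlog : 0 < Real.log (1 + 1 / y) := Real.log_pos (by
      have : 0 < 1 / y := by positivity
      linarith)
    have hx : 0 < Real.log (1 + 1 / y) / a 0 := by positivity
    refine ⟨_, hx, ?_⟩
    have hterm := (ha.summable_boseMean hκ hx).le_tsum 0 fun ℓ _ =>
      mul_nonneg (ha.cast_pos ℓ).le (bose_pos (mul_pos hx (ha.cast_pos ℓ))).le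
    rw [div_mul_cancel₀ _ ha0.ne', bose, Real.exp_log (by positivity), add_sub_cancel_left,
      one_div_one_div] at hterm
    refine le_trans ?_ hterm
    exact le_mul_of_one_le_left hy.le (by exact_mod_cast ha.one_le 0)
  obtain ⟨x₁, hx₁, h₁⟩ := hlarge
  obtain ⟨x₂, hx₂, h₂⟩ := hsmall
  obtain ⟨x, hx, hxy⟩ := isPreconnected_Ioi.intermediate_value hx₁ hx₂ hcont ⟨h₁, h₂⟩
  exact ⟨x, hx, hxy⟩

theorem stmt8 (κ ε : ℝ) (hκ : 0 < κ) (hε : ε ∈ Set.Ioo 0 (1 / (κ + 1))) :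
    ∃ C > 0, ∃ N₀ : ℕ, ∀ n ≥ N₀, ∃ x > 0,
      deriv (Lk κ) x + (n : ℝ) = 0 ∧
      |(pk κ n : ℝ) * Real.sqrt (2 * π * deriv (deriv (Lk κ)) x) *
          Real.exp (-(Lk κ x) - (n : ℝ) * x) - 1| ≤ C * (n : ℝ) ^ (-(1 / (κ + 1)) + ε) := by
  have ha := hasPowerGrowth_psPart hκ
  have hnd : ∀ q ≥ 2, ∀ ℓ₀, ∃ ℓ ≥ ℓ₀, ¬ q ∣ psPart κ (ℓ + 1) := fun q hq ℓ₀ =>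
    exists_not_dvd_psPart hκ hq ℓ₀
  obtain ⟨C₁, hC₁, h₁⟩ := ha.exists_abs_card_mul_sub_one_le hκ hnd
  obtain ⟨C₂, hC₂, h₂⟩ := ha.exists_boseMean_le hκ
  obtain ⟨N₀, hN₀⟩ := exists_nat_ge (max 1 C₂)
  refine ⟨C₁ * C₂ ^ (1 / (κ + 1)), by positivity, N₀, fun n hn => ?_⟩
  have hnN : max 1 C₂ ≤ n := hN₀.trans (by exact_mod_cast hn)
  have hn1 : (1 : ℝ) ≤ n := (le_max_left _ _).trans hnN
  have hnC : C₂ ≤ n := (le_max_right _ _).trans hnN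
  obtain ⟨x, hx, hxn⟩ := ha.exists_boseMean_eq hκ (y := n) (by linarith)
  have hderiv : ∀ y > 0, deriv (Lk κ) y = -boseMean (fun ℓ => psPart κ (ℓ + 1)) y :=
    fun y hy => (ha.hasDerivAt_neg_tsum_log hκ hy).deriv
  have hderiv2 : deriv (deriv (Lk κ)) x = boseVar (fun ℓ => psPart κ (ℓ + 1)) x := by
    have : deriv (Lk κ) =ᶠ[𝓝 x] fun y => -boseMean (fun ℓ => psPart κ (ℓ + 1)) y := by
      filter_upwards [lt_mem_nhds hx] with y hy using hderiv y hy
    rw [this.deriv_eq, (ha.hasDerivAt_boseMean hκ hx).fun_neg.deriv, neg_neg]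
  refine ⟨x, hx, by rw [hderiv x hx, hxn, neg_add_cancel], ?_⟩
  have hpow : x ^ (κ⁻¹ + 1) ≤ C₂ / n := by
    have h := h₂ x hx
    rw [hxn, show -κ⁻¹ - 1 = -(κ⁻¹ + 1) by ring, Real.rpow_neg hx.le, ← div_eq_mul_inv,
      le_div_iff₀ (by positivity)] at h
    rw [le_div_iff₀ (by linarith)]
    linarith
  have hx1 : x ≤ 1 := by
    by_contra! h
    have h3 := Real.one_lt_rpow h (by positivity : 0 < κ⁻¹ + 1)
    have h4 : C₂ / n ≤ 1 := (div_le_one (by linarith)).mpr hnC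
    linarith
  have hxα : x ^ κ⁻¹ ≤ C₂ ^ (1 / (κ + 1)) * (n : ℝ) ^ (-(1 / (κ + 1))) := by
    have h := Real.rpow_le_rpow (by positivity) hpow (by positivity : 0 ≤ 1 / (κ + 1))
    rw [← Real.rpow_mul hx.le, Real.div_rpow hC₂.le (by linarith),
      div_eq_mul_inv (C₂ ^ _), ← Real.rpow_neg (by linarith)] at h
    convert h using 2
    field_simp
    ring
  have hmain := h₁ x hx hx1 n hxn
  rw [hderiv2, Lk, neg_neg, pk]
  refine hmain.trans ?_
  rw [mul_assoc C₁]
  refine mul_le_mul_of_nonneg_left (hxα.trans (mul_le_mul_of_nonneg_left ?_ (by positivity))) hC₁.le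
  exact Real.rpow_le_rpow_of_exponent_le hn1 (by linarith [hε.1])
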